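/- arXiv:1912.12930 — 2 statements merged into one kernel-verified Lean document; each statement's English description precedes it below -/
import Mathlib

section
/- For any six positive integers a₁, a₂, a₃, a₄, a₅, a₆, there exists a positive definite integral ternary quadratic form that represents all six of them. (This is the lower bound κ(1,3) ≥ 6.) -/
open Matrix

/-- A positive definite integral quadratic form of rank `m`. -/
def IsPDForm {m : ℕ} (M : Matrix (Fin m) (Fin m) ℤ) : Prop :=
  M.IsSymm ∧ ∀ x : Fin m → ℤ, x ≠ 0 → 0 < x ⬝ᵥ M.mulVec x

/-- `N` is represented by `L` if `Tᵀ L T = N` for some integer matrix `T`. -/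
def Represents {n m : ℕ} (L : Matrix (Fin n) (Fin n) ℤ)
    (N : Matrix (Fin m) (Fin m) ℤ) : Prop :=
  ∃ T : Matrix (Fin n) (Fin m) ℤ, Tᵀ * L * T = N

/-- An integer `a` is represented by the form `M`. -/
def RepresentsInt {m : ℕ} (M : Matrix (Fin m) (Fin m) ℤ) (a : ℤ) : Prop :=
  ∃ x : Fin m → ℤ, x ⬝ᵥ M.mulVec x = a

/-- Two integral forms of rank `n` are isometric. -/
def IsomForm {n : ℕ} (A B : Matrix (Fin n) (Fin n) ℤ) : Prop :=
  ∃ U : Matrix (Fin n) (Fin n) ℤ, IsUnit U.det ∧ Uᵀ * A * U = B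

/-! ### Ternary forms as six-tuples -/

/-- Value of the ternary form with Gram matrix `[[a,t,s],[t,b,r],[s,r,c]]`. -/
def qv (a b c r s t x y z : ℤ) : ℤ :=
  a * x * x + b * y * y + c * z * z + 2 * r * y * z + 2 * s * x * z + 2 * t * x * y

/-- Positive definite forms of determinant `d` representing `n`, with a vector isotropic
modulo `p` that is not in the radical modulo `p`. -/
structure Good (d p n a b c r s t : ℤ) : Prop where
  ha : 0 < a
  hP : 0 < a * b - t ^ 2
  hd : a * b * c + 2 * r * s * t - a * r ^ 2 - b * s ^ 2 - c * t ^ 2 = d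
  rep : ∃ x y z, qv a b c r s t x y z = n
  iso : ∃ x y z, p ∣ qv a b c r s t x y z ∧
    ¬ (p ∣ a * x + t * y + s * z ∧ p ∣ t * x + b * y + r * z ∧ p ∣ s * x + r * y + c * z)

/-- Replace `e₂` by `e₂ + k e₁`. -/
lemma Good.shift12 {d p n a b c r s t : ℤ} (h : Good d p n a b c r s t) (k : ℤ) :
    Good d p n a (b + 2 * k * t + k ^ 2 * a) c (r + k * s) s (t + k * a) := by
  obtain ⟨ha, hP, hd, ⟨x, y, z, hx⟩, ⟨u, v, w, hu, hv⟩⟩ := h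
  refine ⟨ha, ?_, ?_, ⟨x - k * y, y, z, ?_⟩, ⟨u - k * v, v, w, ?_, ?_⟩⟩
  · linarith
  · rw [← hd]; ring
  · rw [← hx]; unfold qv; ring
  · convert hu using 1; unfold qv; ring
  · rintro ⟨h1, h2, h3⟩
    have e1 : p ∣ a * u + t * v + s * w := by convert h1 using 1; ring
    refine hv ⟨e1, ?_, ?_⟩
    · obtain ⟨i, hi⟩ := h2
      obtain ⟨j, hj⟩ := e1
      exact ⟨i - k * j, by linear_combination hi - k * hj⟩
    · convert h3 using 1; ring

/-- Replace `e₃` by `e₃ + k e₁`. -/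
lemma Good.shift13 {d p n a b c r s t : ℤ} (h : Good d p n a b c r s t) (k : ℤ) :
    Good d p n a b (c + 2 * k * s + k ^ 2 * a) (r + k * t) (s + k * a) t := by
  obtain ⟨ha, hP, hd, ⟨x, y, z, hx⟩, ⟨u, v, w, hu, hv⟩⟩ := h
  refine ⟨ha, hP, ?_, ⟨x - k * z, y, z, ?_⟩, ⟨u - k * w, v, w, ?_, ?_⟩⟩
  · rw [← hd]; ring
  · rw [← hx]; unfold qv; ring
  · convert hu using 1; unfold qv; ring
  · rintro ⟨h1, h2, h3⟩
    have e1 : p ∣ a * u + t * v + s * w := by convert h1 using 1; ring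
    refine hv ⟨e1, ?_, ?_⟩
    · convert h2 using 1; ring
    · obtain ⟨i, hi⟩ := h3
      obtain ⟨j, hj⟩ := e1
      exact ⟨i - k * j, by linear_combination hi - k * hj⟩

/-- Replace `e₃` by `e₃ + k e₂`. -/
lemma Good.shift23 {d p n a b c r s t : ℤ} (h : Good d p n a b c r s t) (k : ℤ) :
    Good d p n a b (c + 2 * k * r + k ^ 2 * b) (r + k * b) (s + k * t) t := by
  obtain ⟨ha, hP, hd, ⟨x, y, z, hx⟩, ⟨u, v, w, hu, hv⟩⟩ := h
  refine ⟨ha, hP, ?_, ⟨x, y - k * z, z, ?_⟩, ⟨u, v - k * w, w, ?_, ?_⟩⟩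
  · rw [← hd]; ring
  · rw [← hx]; unfold qv; ring
  · convert hu using 1; unfold qv; ring
  · rintro ⟨h1, h2, h3⟩
    have e2 : p ∣ t * u + b * v + r * w := by convert h2 using 1; ring
    refine hv ⟨?_, e2, ?_⟩
    · convert h1 using 1; ring
    · obtain ⟨i, hi⟩ := h3
      obtain ⟨j, hj⟩ := e2
      exact ⟨i - k * j, by linear_combination hi - k * hj⟩

/-- Swap `e₁` and `e₂`. -/
lemma Good.swap12 {d p n a b c r s t : ℤ} (h : Good d p n a b c r s t) :
    Good d p n b a c s r t := by
  obtain ⟨ha, hP, hd, ⟨x, y, z, hx⟩, ⟨u, v, w, hu, hv⟩⟩ := h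
  refine ⟨?_, ?_, ?_, ⟨y, x, z, ?_⟩, ⟨v, u, w, ?_, ?_⟩⟩
  · nlinarith [sq_nonneg t]
  · linarith
  · rw [← hd]; ring
  · rw [← hx]; unfold qv; ring
  · convert hu using 1; unfold qv; ring
  · rintro ⟨h1, h2, h3⟩
    refine hv ⟨?_, ?_, ?_⟩
    · convert h2 using 1; ring
    · convert h1 using 1; ring
    · convert h3 using 1; ring

/-- Swap `e₂` and `e₃`. -/
lemma Good.swap23 {d p n a b c r s t : ℤ} (hd0 : 0 < d) (h : Good d p n a b c r s t) :
    Good d p n a c b r t s := by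
  obtain ⟨ha, hP, hd, ⟨x, y, z, hx⟩, ⟨u, v, w, hu, hv⟩⟩ := h
  refine ⟨ha, ?_, ?_, ⟨x, z, y, ?_⟩, ⟨u, w, v, ?_, ?_⟩⟩
  · have h1 : (a * b - t ^ 2) * (a * c - s ^ 2) = a * d + (a * r - s * t) ^ 2 := by
      rw [← hd]; ring
    have h2 : 0 < a * d + (a * r - s * t) ^ 2 := by positivity
    rw [← h1] at h2
    exact (pos_iff_pos_of_mul_pos h2).1 hP
  · rw [← hd]; ring
  · rw [← hx]; unfold qv; ring
  · convert hu using 1; unfold qv; ring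
  · rintro ⟨h1, h2, h3⟩
    refine hv ⟨?_, ?_, ?_⟩
    · convert h1 using 1; ring
    · convert h3 using 1; ring
    · convert h2 using 1; ring

lemma exists_near (a t : ℤ) (ha : 0 < a) : ∃ k : ℤ, -a ≤ 2 * (t + k * a) ∧ 2 * (t + k * a) ≤ a := by
  refine ⟨-((2 * t + a) / (2 * a)), ?_⟩
  have h1 := Int.emod_add_mul_ediv (2 * t + a) (2 * a)
  have h2 := Int.emod_nonneg (2 * t + a) (b := 2 * a) (by omega)
  have h3 := Int.emod_lt_of_pos (2 * t + a) (b := 2 * a) (by omega)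
  constructor <;> nlinarith

/-- Hermite reduction of a positive definite ternary form. -/
lemma Good.reduce {d p n a b c r s t : ℤ} (hd0 : 0 < d) (h : Good d p n a b c r s t) :
    ∃ a b c r s t : ℤ, Good d p n a b c r s t ∧ (-a ≤ 2 * t ∧ 2 * t ≤ a) ∧
      (-a ≤ 2 * s ∧ 2 * s ≤ a) ∧ a ≤ b ∧ a * b - t ^ 2 ≤ a * c - s ^ 2 ∧
      -(a * b - t ^ 2) ≤ 2 * (a * r - s * t) ∧ 2 * (a * r - s * t) ≤ a * b - t ^ 2 := by
  obtain ⟨A, ⟨b1, c1, r1, s1, t1, hA⟩, hAmin⟩ :=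
    Int.exists_least_of_bdd (P := fun a => ∃ b c r s t, Good d p n a b c r s t)
      ⟨0, fun z ⟨_, _, _, _, _, hz⟩ => hz.ha.le⟩ ⟨a, b, c, r, s, t, h⟩
  obtain ⟨P, ⟨b2, c2, r2, s2, t2, hG, hPe⟩, hPmin⟩ :=
    Int.exists_least_of_bdd
      (P := fun P => ∃ b c r s t, Good d p n A b c r s t ∧ A * b - t ^ 2 = P)
      ⟨0, fun z ⟨_, _, _, _, _, hz, he⟩ => he ▸ hz.hP.le⟩ ⟨_, b1, c1, r1, s1, t1, hA, rfl⟩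
  have hApos := hG.ha
  have hPpos := hG.hP
  obtain ⟨k1, hk1⟩ := exists_near (A * b2 - t2 ^ 2) (A * r2 - s2 * t2) hPpos
  have G1 := hG.shift23 k1
  obtain ⟨k2, hk2⟩ := exists_near A t2 hApos
  have G2 := G1.shift12 k2
  obtain ⟨k3, hk3⟩ := exists_near A (s2 + k1 * t2) hApos
  have G3 := G2.shift13 k3
  refine ⟨_, _, _, _, _, _, G3, hk2, hk3, hAmin _ ⟨_, _, _, _, _, G3.swap12⟩, ?_, ?_, ?_⟩
  · have := hPmin _ ⟨_, _, _, _, _, G3.swap23 hd0, rfl⟩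
    refine le_trans (le_of_eq ?_) this
    rw [← hPe]; ring
  · convert hk1.1 using 1 <;> ring
  · convert hk1.2 using 1 <;> ring

lemma reduced_bounds {d p n a b c r s t : ℤ} (h : Good d p n a b c r s t)
    (ht : -a ≤ 2 * t ∧ 2 * t ≤ a) (hab : a ≤ b)
    (hPR : a * b - t ^ 2 ≤ a * c - s ^ 2)
    (hQ1 : -(a * b - t ^ 2) ≤ 2 * (a * r - s * t)) (hQ2 : 2 * (a * r - s * t) ≤ a * b - t ^ 2) :
    3 * a ^ 2 ≤ 4 * (a * b - t ^ 2) ∧ 3 * (a * b - t ^ 2) ^ 2 ≤ 4 * (a * d) ∧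
      27 * a ^ 3 ≤ 64 * d := by
  have ha := h.ha
  have hP := h.hP
  have h1 : (a * b - t ^ 2) * (a * c - s ^ 2) = a * d + (a * r - s * t) ^ 2 := by
    rw [← h.hd]; ring
  have e1 : 3 * a ^ 2 ≤ 4 * (a * b - t ^ 2) := by nlinarith
  set P := a * b - t ^ 2 with hPdef
  set Q := a * r - s * t
  set R := a * c - s ^ 2
  have hQ : 4 * Q ^ 2 ≤ P ^ 2 := by nlinarith
  have hPR' : P * P ≤ P * R := by nlinarith
  have e2 : 3 * P ^ 2 ≤ 4 * (a * d) := by nlinarith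
  refine ⟨e1, e2, ?_⟩
  have e3 : 9 * a ^ 4 ≤ 16 * P ^ 2 := by nlinarith [sq_nonneg a]
  have e4 : a * (27 * a ^ 3) ≤ a * (64 * d) := by nlinarith
  exact le_of_mul_le_mul_left e4 ha

/-! ### Classification of the reduced forms -/

lemma not_iso (p : ℕ) (a b c r s t : ℤ)
    (h : ∀ x y z : ZMod p, (a : ZMod p) * x * x + b * y * y + c * z * z + 2 * r * y * z
        + 2 * s * x * z + 2 * t * x * y = 0 →
      (a : ZMod p) * x + t * y + s * z = 0 ∧ (t : ZMod p) * x + b * y + r * z = 0 ∧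
        (s : ZMod p) * x + r * y + c * z = 0) {d n : ℤ}
    (hG : Good d p n a b c r s t) : False := by
  obtain ⟨x, y, z, h1, h2⟩ := hG.iso
  apply h2
  have := h x y z (by
    rw [← ZMod.intCast_zmod_eq_zero_iff_dvd] at h1
    simpa [qv] using h1)
  refine ⟨?_, ?_, ?_⟩
  · rw [← ZMod.intCast_zmod_eq_zero_iff_dvd]; simpa using this.1
  · rw [← ZMod.intCast_zmod_eq_zero_iff_dvd]; simpa using this.2.1
  · rw [← ZMod.intCast_zmod_eq_zero_iff_dvd]; simpa using this.2.2

/-- All reduced forms of determinant `d ≤ 14` have small entries. -/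
lemma Good.small {d p n a b c r s t : ℤ} (hd0 : 0 < d) (hd14 : d ≤ 14)
    (h : Good d p n a b c r s t) :
    ∃ a b c r s t : ℤ, Good d p n a b c r s t ∧ (-a ≤ 2 * t ∧ 2 * t ≤ a) ∧
      (-a ≤ 2 * s ∧ 2 * s ≤ a) ∧ a ≤ b ∧ a * b - t ^ 2 ≤ a * c - s ^ 2 ∧
      -(a * b - t ^ 2) ≤ 2 * (a * r - s * t) ∧ 2 * (a * r - s * t) ≤ a * b - t ^ 2 ∧
      0 < a ∧ a ≤ 3 ∧ 27 * a ^ 3 ≤ 64 * d ∧ 0 < a * b - t ^ 2 ∧ a * b - t ^ 2 ≤ 7 ∧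
      3 * (a * b - t ^ 2) ^ 2 ≤ 4 * (a * d) ∧
      a * b * c + 2 * r * s * t - a * r ^ 2 - b * s ^ 2 - c * t ^ 2 = d := by
  obtain ⟨a, b, c, r, s, t, hG, ht, hs, hab, hPR, hQ1, hQ2⟩ := h.reduce hd0
  obtain ⟨e1, e2, e3⟩ := reduced_bounds hG ht hab hPR hQ1 hQ2
  have ha := hG.ha
  have ha3 : a ≤ 3 := by
    by_contra hcon
    have h4 : 4 ≤ a := by omega
    have : (4 : ℤ) ^ 3 ≤ a ^ 3 := pow_le_pow_left₀ (by norm_num) h4 3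
    omega
  have hP7 : a * b - t ^ 2 ≤ 7 := by
    by_contra hcon
    have h8 : 8 ≤ a * b - t ^ 2 := by omega
    nlinarith
  exact ⟨a, b, c, r, s, t, hG, ht, hs, hab, hPR, hQ1, hQ2, ha, ha3, e3, hG.hP, hP7, e2, hG.hd⟩

lemma class1 {n a b c r s t : ℤ} (h : Good 1 3 n a b c r s t) :
    ∃ x y z, qv 1 1 1 0 0 0 x y z = n := by
  obtain ⟨a, b, c, r, s, t, hG, ht, hs, hab, hPR, hQ1, hQ2, ha, ha3, e3, hP, hP7, e2, hd⟩ :=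
    h.small (by norm_num) (by norm_num)
  have ht1 : -1 ≤ t := by omega
  have ht2 : t ≤ 1 := by omega
  have hs1 : -1 ≤ s := by omega
  have hs2 : s ≤ 1 := by omega
  interval_cases a <;> interval_cases t <;> first | omega | interval_cases s <;> first | omega | skip
  all_goals
    have hb1 : 1 ≤ b := by omega
    have hb2 : b ≤ 7 := by omega
    interval_cases b <;> first | omega | skip
  all_goals
    have hr1 : -7 ≤ r := by omega
    have hr2 : r ≤ 7 := by omega
    interval_cases r <;> first | omega | skip
  all_goals
    have hc1 : 1 ≤ c := by omega
    have hc2 : c ≤ 14 := by omega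
    interval_cases c <;> first | omega | skip
  · obtain ⟨x, y, z, hx⟩ := hG.rep
    exact ⟨(-1) * x, (-1) * y, (-1) * z, by rw [← hx]; unfold qv; ring⟩

lemma class2 {n a b c r s t : ℤ} (h : Good 2 3 n a b c r s t) :
    ∃ x y z, qv 1 1 2 0 0 0 x y z = n := by
  obtain ⟨a, b, c, r, s, t, hG, ht, hs, hab, hPR, hQ1, hQ2, ha, ha3, e3, hP, hP7, e2, hd⟩ :=
    h.small (by norm_num) (by norm_num)
  have ht1 : -1 ≤ t := by omega
  have ht2 : t ≤ 1 := by omega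
  have hs1 : -1 ≤ s := by omega
  have hs2 : s ≤ 1 := by omega
  interval_cases a <;> interval_cases t <;> first | omega | interval_cases s <;> first | omega | skip
  all_goals
    have hb1 : 1 ≤ b := by omega
    have hb2 : b ≤ 7 := by omega
    interval_cases b <;> first | omega | skip
  all_goals
    have hr1 : -7 ≤ r := by omega
    have hr2 : r ≤ 7 := by omega
    interval_cases r <;> first | omega | skip
  all_goals
    have hc1 : 1 ≤ c := by omega
    have hc2 : c ≤ 14 := by omega
    interval_cases c <;> first | omega | skip
  · obtain ⟨x, y, z, hx⟩ := hG.rep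
    exact ⟨(-1) * x, (-1) * y, (-1) * z, by rw [← hx]; unfold qv; ring⟩

lemma class3 {n a b c r s t : ℤ} (h : Good 3 3 n a b c r s t) :
    ∃ x y z, qv 1 2 2 1 0 0 x y z = n := by
  obtain ⟨a, b, c, r, s, t, hG, ht, hs, hab, hPR, hQ1, hQ2, ha, ha3, e3, hP, hP7, e2, hd⟩ :=
    h.small (by norm_num) (by norm_num)
  have ht1 : -1 ≤ t := by omega
  have ht2 : t ≤ 1 := by omega
  have hs1 : -1 ≤ s := by omega
  have hs2 : s ≤ 1 := by omega
  interval_cases a <;> interval_cases t <;> first | omega | interval_cases s <;> first | omega | skip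
  all_goals
    have hb1 : 1 ≤ b := by omega
    have hb2 : b ≤ 7 := by omega
    interval_cases b <;> first | omega | skip
  all_goals
    have hr1 : -7 ≤ r := by omega
    have hr2 : r ≤ 7 := by omega
    interval_cases r <;> first | omega | skip
  all_goals
    have hc1 : 1 ≤ c := by omega
    have hc2 : c ≤ 14 := by omega
    interval_cases c <;> first | omega | skip
  · exact (not_iso 3 1 1 3 0 0 0 (by decide) hG).elim
  · obtain ⟨x, y, z, hx⟩ := hG.rep
    exact ⟨(-1) * x, (-1) * y, (1) * z, by rw [← hx]; unfold qv; ring⟩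
  · obtain ⟨x, y, z, hx⟩ := hG.rep
    exact ⟨(-1) * x, (-1) * y + (-1) * z, (1) * z, by rw [← hx]; unfold qv; ring⟩

lemma class5 {n a b c r s t : ℤ} (h : Good 5 5 n a b c r s t) :
    ∃ x y z, qv 1 1 5 0 0 0 x y z = n := by
  obtain ⟨a, b, c, r, s, t, hG, ht, hs, hab, hPR, hQ1, hQ2, ha, ha3, e3, hP, hP7, e2, hd⟩ :=
    h.small (by norm_num) (by norm_num)
  have ht1 : -1 ≤ t := by omega
  have ht2 : t ≤ 1 := by omega
  have hs1 : -1 ≤ s := by omega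
  have hs2 : s ≤ 1 := by omega
  interval_cases a <;> interval_cases t <;> first | omega | interval_cases s <;> first | omega | skip
  all_goals
    have hb1 : 1 ≤ b := by omega
    have hb2 : b ≤ 7 := by omega
    interval_cases b <;> first | omega | skip
  all_goals
    have hr1 : -7 ≤ r := by omega
    have hr2 : r ≤ 7 := by omega
    interval_cases r <;> first | omega | skip
  all_goals
    have hc1 : 1 ≤ c := by omega
    have hc2 : c ≤ 14 := by omega
    interval_cases c <;> first | omega | skip
  · obtain ⟨x, y, z, hx⟩ := hG.rep
    exact ⟨(-1) * x, (-1) * y, (-1) * z, by rw [← hx]; unfold qv; ring⟩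
  · exact (not_iso 5 1 2 3 (-1) 0 0 (by decide) hG).elim
  · exact (not_iso 5 1 2 3 1 0 0 (by decide) hG).elim

lemma class6 {n a b c r s t : ℤ} (h : Good 6 3 n a b c r s t) :
    ∃ x y z, qv 1 2 3 0 0 0 x y z = n := by
  obtain ⟨a, b, c, r, s, t, hG, ht, hs, hab, hPR, hQ1, hQ2, ha, ha3, e3, hP, hP7, e2, hd⟩ :=
    h.small (by norm_num) (by norm_num)
  have ht1 : -1 ≤ t := by omega
  have ht2 : t ≤ 1 := by omega
  have hs1 : -1 ≤ s := by omega
  have hs2 : s ≤ 1 := by omega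
  interval_cases a <;> interval_cases t <;> first | omega | interval_cases s <;> first | omega | skip
  all_goals
    have hb1 : 1 ≤ b := by omega
    have hb2 : b ≤ 7 := by omega
    interval_cases b <;> first | omega | skip
  all_goals
    have hr1 : -7 ≤ r := by omega
    have hr2 : r ≤ 7 := by omega
    interval_cases r <;> first | omega | skip
  all_goals
    have hc1 : 1 ≤ c := by omega
    have hc2 : c ≤ 14 := by omega
    interval_cases c <;> first | omega | skip
  · exact (not_iso 3 1 1 6 0 0 0 (by decide) hG).elim
  · obtain ⟨x, y, z, hx⟩ := hG.rep
    exact ⟨(-1) * x, (-1) * y, (-1) * z, by rw [← hx]; unfold qv; ring⟩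
  · exact (not_iso 3 2 2 2 0 0 (-1) (by decide) hG).elim
  · exact (not_iso 3 2 2 2 (-1) 0 0 (by decide) hG).elim
  · exact (not_iso 3 2 2 2 1 0 0 (by decide) hG).elim
  · exact (not_iso 3 2 2 2 0 0 1 (by decide) hG).elim

lemma class7 {n a b c r s t : ℤ} (h : Good 7 7 n a b c r s t) :
    ∃ x y z, qv 2 2 3 1 1 1 x y z = n := by
  obtain ⟨a, b, c, r, s, t, hG, ht, hs, hab, hPR, hQ1, hQ2, ha, ha3, e3, hP, hP7, e2, hd⟩ :=
    h.small (by norm_num) (by norm_num)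
  have ht1 : -1 ≤ t := by omega
  have ht2 : t ≤ 1 := by omega
  have hs1 : -1 ≤ s := by omega
  have hs2 : s ≤ 1 := by omega
  interval_cases a <;> interval_cases t <;> first | omega | interval_cases s <;> first | omega | skip
  all_goals
    have hb1 : 1 ≤ b := by omega
    have hb2 : b ≤ 7 := by omega
    interval_cases b <;> first | omega | skip
  all_goals
    have hr1 : -7 ≤ r := by omega
    have hr2 : r ≤ 7 := by omega
    interval_cases r <;> first | omega | skip
  all_goals
    have hc1 : 1 ≤ c := by omega
    have hc2 : c ≤ 14 := by omega
    interval_cases c <;> first | omega | skip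
  · exact (not_iso 7 1 1 7 0 0 0 (by decide) hG).elim
  · exact (not_iso 7 1 2 4 (-1) 0 0 (by decide) hG).elim
  · exact (not_iso 7 1 2 4 1 0 0 (by decide) hG).elim
  · obtain ⟨x, y, z, hx⟩ := hG.rep
    exact ⟨(-1) * x + (1) * z, (1) * y, (-1) * z, by rw [← hx]; unfold qv; ring⟩
  · obtain ⟨x, y, z, hx⟩ := hG.rep
    exact ⟨(-1) * x, (1) * y, (1) * z, by rw [← hx]; unfold qv; ring⟩
  · obtain ⟨x, y, z, hx⟩ := hG.rep
    exact ⟨(-1) * x, (1) * y, (-1) * z, by rw [← hx]; unfold qv; ring⟩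
  · obtain ⟨x, y, z, hx⟩ := hG.rep
    exact ⟨(-1) * x + (-1) * z, (1) * y, (1) * z, by rw [← hx]; unfold qv; ring⟩
  · obtain ⟨x, y, z, hx⟩ := hG.rep
    exact ⟨(-1) * x + (-1) * y + (1) * z, (1) * y, (-1) * z, by rw [← hx]; unfold qv; ring⟩
  · obtain ⟨x, y, z, hx⟩ := hG.rep
    exact ⟨(-1) * x + (-1) * y, (1) * y, (1) * z, by rw [← hx]; unfold qv; ring⟩
  · obtain ⟨x, y, z, hx⟩ := hG.rep
    exact ⟨(-1) * x + (-1) * y, (1) * y, (-1) * z, by rw [← hx]; unfold qv; ring⟩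
  · obtain ⟨x, y, z, hx⟩ := hG.rep
    exact ⟨(-1) * x + (-1) * y + (-1) * z, (1) * y, (1) * z, by rw [← hx]; unfold qv; ring⟩

lemma class14 {n a b c r s t : ℤ} (h : Good 14 7 n a b c r s t) :
    ∃ x y z, qv 1 3 5 1 0 0 x y z = n := by
  obtain ⟨a, b, c, r, s, t, hG, ht, hs, hab, hPR, hQ1, hQ2, ha, ha3, e3, hP, hP7, e2, hd⟩ :=
    h.small (by norm_num) (by norm_num)
  have ht1 : -1 ≤ t := by omega
  have ht2 : t ≤ 1 := by omega
  have hs1 : -1 ≤ s := by omega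
  have hs2 : s ≤ 1 := by omega
  interval_cases a <;> interval_cases t <;> first | omega | interval_cases s <;> first | omega | skip
  all_goals
    have hb1 : 1 ≤ b := by omega
    have hb2 : b ≤ 7 := by omega
    interval_cases b <;> first | omega | skip
  all_goals
    have hr1 : -7 ≤ r := by omega
    have hr2 : r ≤ 7 := by omega
    interval_cases r <;> first | omega | skip
  all_goals
    have hc1 : 1 ≤ c := by omega
    have hc2 : c ≤ 14 := by omega
    interval_cases c <;> first | omega | skip
  · exact (not_iso 7 1 1 14 0 0 0 (by decide) hG).elim
  · exact (not_iso 7 1 2 7 0 0 0 (by decide) hG).elim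
  · obtain ⟨x, y, z, hx⟩ := hG.rep
    exact ⟨(-1) * x, (-1) * y, (1) * z, by rw [← hx]; unfold qv; ring⟩
  · obtain ⟨x, y, z, hx⟩ := hG.rep
    exact ⟨(-1) * x, (-1) * y, (-1) * z, by rw [← hx]; unfold qv; ring⟩
  · exact (not_iso 7 2 2 4 0 (-1) 0 (by decide) hG).elim
  · exact (not_iso 7 2 2 4 (-1) 0 0 (by decide) hG).elim
  · exact (not_iso 7 2 2 4 1 0 0 (by decide) hG).elim
  · exact (not_iso 7 2 2 4 0 1 0 (by decide) hG).elim

/-! ### Arithmetic: construction of forms -/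

lemma exists_prime_crt (D : ℕ) (hD : D % 2 = 1) (u v : ℤ) (hu : IsCoprime u (D : ℤ))
    (hv : v % 2 = 1) (B : ℕ) :
    ∃ q : ℕ, B < q ∧ q.Prime ∧ (D : ℤ) ∣ q - u ∧ (8 : ℤ) ∣ q - v := by
  have h8 : (8 : ℤ) ∣ (D : ℤ) * D - 1 := by
    have : (D : ℤ) % 8 = 1 ∨ (D : ℤ) % 8 = 3 ∨ (D : ℤ) % 8 = 5 ∨ (D : ℤ) % 8 = 7 := by omega
    apply Int.dvd_of_emod_eq_zero
    rcases this with h | h | h | h <;> simp [Int.sub_emod, Int.mul_emod, h]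
  obtain ⟨e, he⟩ := h8
  set w : ℤ := u + D * D * (v - u) with hw
  have hw8 : w = v + 8 * (e * (v - u)) := by
    rw [hw]; linear_combination (v - u) * he
  have c1 : IsCoprime w (D : ℤ) := by
    rw [hw, mul_assoc]
    exact hu.add_mul_left_left _
  have c2 : IsCoprime w (8 : ℤ) := by
    have : IsCoprime w (2 : ℤ) := by
      have h2 : w % 2 = 1 := by omega
      exact ⟨1, -(w / 2), by omega⟩
    have := this.pow_right (n := 3)
    norm_num at this
    exact this
  have c3 : IsCoprime w ((8 * D : ℕ) : ℤ) := by
    push_cast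
    exact c2.mul_right c1
  obtain ⟨q, hq1, hq2, hq3⟩ := Nat.forall_exists_prime_gt_and_zmodEq B (q := 8 * D) (a := w)
    (by omega) c3
  have h1 : ((8 * D : ℕ) : ℤ) ∣ q - w := hq3.symm.dvd
  push_cast at h1
  refine ⟨q, hq1, hq2, ?_, ?_⟩
  · have := (Dvd.intro_left _ rfl : (D : ℤ) ∣ 8 * D).trans h1
    obtain ⟨j, hj⟩ := this
    exact ⟨j + D * (v - u), by linear_combination hj + hw⟩
  · have := (Dvd.intro _ rfl : (8 : ℤ) ∣ 8 * D).trans h1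
    omega

open NumberTheorySymbols in
lemma jac1 (m q : ℕ) (hm : m % 4 = 1) (hq : q % 4 = 1) (h : (m : ℤ) ∣ q + 1) :
    J(-(m : ℤ) | q) = 1 := by
  have hqo : Odd q := Nat.odd_iff.2 (by omega)
  have hmo : Odd m := Nat.odd_iff.2 (by omega)
  rw [jacobiSym.neg _ hqo, ZMod.χ₄_nat_one_mod_four hq, one_mul,
    jacobiSym.quadratic_reciprocity_one_mod_four' hmo hq,
    jacobiSym.mod_left' (a₂ := -1), jacobiSym.at_neg_one hmo, ZMod.χ₄_nat_one_mod_four hm]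
  exact Int.emod_eq_emod_iff_emod_sub_eq_zero.2 (Int.emod_eq_zero_of_dvd (by simpa using h))

open NumberTheorySymbols in
lemma jac2 (m q : ℕ) (hm : m % 8 = 1 ∨ m % 8 = 3) (hq : q % 4 = 1)
    (h : (m : ℤ) ∣ 4 * q + 2 ∨ (m : ℤ) ∣ q + 2) :
    J(-(m : ℤ) | q) = 1 := by
  have hqo : Odd q := Nat.odd_iff.2 (by omega)
  have hmo : Odd m := Nat.odd_iff.2 (by omega)
  have h2 : J(-2 | m) = 1 := by
    rw [jacobiSym.at_neg_two hmo, ZMod.χ₈'_nat_eq_if_mod_eight]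
    rcases hm with hm | hm <;> simp [hm] <;> omega
  rw [jacobiSym.neg _ hqo, ZMod.χ₄_nat_one_mod_four hq, one_mul,
    jacobiSym.quadratic_reciprocity_one_mod_four' hmo hq]
  rcases h with h | h
  · have e : J(4 * (q : ℤ) | m) = J(-2 | m) := by
      apply jacobiSym.mod_left'
      exact (Int.emod_eq_emod_iff_emod_sub_eq_zero.2
        (Int.emod_eq_zero_of_dvd (by simpa using h)))
    rwa [jacobiSym.mul_left, jacobiSym.at_four hmo, one_mul, h2] at e
  · rw [← h2]
    apply jacobiSym.mod_left'
    exact Int.emod_eq_emod_iff_emod_sub_eq_zero.2 (Int.emod_eq_zero_of_dvd (by simpa using h))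

open NumberTheorySymbols in
lemma jac3 (m q : ℕ) (hm : m % 2 = 1) (hq : q % 8 = 3) (h : (m : ℤ) ∣ q + 1) :
    J(-((2 * m : ℕ) : ℤ) | q) = 1 := by
  have hqo : Odd q := Nat.odd_iff.2 (by omega)
  have hmo : Odd m := Nat.odd_iff.2 (by omega)
  have h2 : J(-2 | q) = 1 := by
    rw [jacobiSym.at_neg_two hqo, ZMod.χ₈'_nat_eq_if_mod_eight]
    simp [hq]; omega
  have hqm : J((q : ℤ) | m) = J(-1 | m) := by
    apply jacobiSym.mod_left'
    exact Int.emod_eq_emod_iff_emod_sub_eq_zero.2 (Int.emod_eq_zero_of_dvd (by simpa using h))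
  have e : -((2 * m : ℕ) : ℤ) = -2 * (m : ℤ) := by push_cast; ring
  rw [e, jacobiSym.mul_left, h2, one_mul]
  rcases (by omega : m % 4 = 1 ∨ m % 4 = 3) with h4 | h4
  · rw [jacobiSym.quadratic_reciprocity_one_mod_four h4 hqo, hqm, jacobiSym.at_neg_one hmo,
      ZMod.χ₄_nat_one_mod_four h4]
  · rw [jacobiSym.quadratic_reciprocity_three_mod_four h4 (by omega), hqm,
      jacobiSym.at_neg_one hmo, ZMod.χ₄_nat_three_mod_four h4]
    norm_num

open NumberTheorySymbols in
lemma exists_sq (q n d : ℕ) (hq : q.Prime) (hn0 : 0 < n) (hn : n < q)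
    (h : J(-((n * d : ℕ) : ℤ) | q) = 1) :
    ∃ x : ℤ, (q : ℤ) ∣ d + n * x ^ 2 := by
  have := Fact.mk hq
  obtain ⟨y, hy⟩ := ZMod.isSquare_of_jacobiSym_eq_one h
  have hne : (n : ZMod q) ≠ 0 := by
    rw [Ne, ZMod.natCast_eq_zero_iff]
    exact Nat.not_dvd_of_pos_of_lt hn0 hn
  obtain ⟨x, hx⟩ := ZMod.intCast_surjective (y / (n : ZMod q))
  refine ⟨x, ?_⟩
  rw [← ZMod.intCast_zmod_eq_zero_iff_dvd]
  push_cast at hy ⊢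
  rw [hx]
  field_simp
  linear_combination -hy

/-- The form `[[p k, x, h], [x, a, 0], [h, 0, n]]`. -/
lemma good_of (d p n h k a x : ℤ) (hd : 0 < d) (hn : 0 < n) (hph : ¬ p ∣ h)
    (hA : 0 < n * (p * k) - h ^ 2) (hdet : a * (n * (p * k) - h ^ 2) - n * x ^ 2 = d) :
    Good d p n (p * k) a n 0 h x := by
  have ha : 0 < a := by
    have : 0 < a * (n * (p * k) - h ^ 2) := by nlinarith [sq_nonneg x]
    exact (pos_iff_pos_of_mul_pos this).2 hA
  have hk : 0 < p * k := by
    have : 0 < n * (p * k) := by nlinarith [sq_nonneg h]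
    exact (pos_iff_pos_of_mul_pos this).1 hn
  refine ⟨hk, ?_, ?_, ⟨0, 0, 1, ?_⟩, ⟨1, 0, 0, ?_, ?_⟩⟩
  · have e : n * (p * k * a - x ^ 2) = d + h ^ 2 * a := by rw [← hdet]; ring
    have : 0 < n * (p * k * a - x ^ 2) := by rw [e]; positivity
    exact (pos_iff_pos_of_mul_pos this).1 hn
  · rw [← hdet]; ring
  · unfold qv; ring
  · exact ⟨k, by unfold qv; ring⟩
  · rintro ⟨-, -, h3⟩
    apply hph
    simpa using h3

lemma coprime_neg_one (D : ℤ) : IsCoprime (-1 : ℤ) D := ⟨-1, 0, by ring⟩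

lemma coprime_neg_two (D : ℕ) (hD : D % 2 = 1) : IsCoprime (-2 : ℤ) (D : ℤ) :=
  ⟨((D / 2 : ℕ) : ℤ), 1, by omega⟩

/-- `n` and `d` both odd. -/
lemma exists_good_odd_odd (d p n : ℕ) (hp : p % 2 = 1) (hp1 : 1 < p) (hdp : d ∣ p)
    (hn : n % 2 = 1) (hm : (n * d) % 8 ≠ 7) :
    ∃ a b c r s t : ℤ, Good d p n a b c r s t := by
  have hd : d % 2 = 1 := by
    obtain ⟨e, rfl⟩ := hdp
    rcases Nat.mod_two_eq_zero_or_one d with h | h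
    · simp [Nat.mul_mod, h] at hp
    · exact h
  have hD : (n * p) % 2 = 1 := by simp [Nat.mul_mod, hn, hp]
  have hm2 : (n * d) % 2 = 1 := by simp [Nat.mul_mod, hn, hd]
  have hmD : ((n * d : ℕ) : ℤ) ∣ ((n * p : ℕ) : ℤ) := by exact_mod_cast Nat.mul_dvd_mul_left n hdp
  have hp1' : ¬ (p : ℤ) ∣ 1 := by
    intro h
    have := Int.le_of_dvd one_pos h
    omega
  by_cases h4 : (n * d) % 4 = 1
  · obtain ⟨q, hqn, hq, hqD, hq8⟩ := exists_prime_crt (n * p) hD (-1) 1 (coprime_neg_one _)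
      (by norm_num) n
    rw [sub_neg_eq_add] at hqD
    obtain ⟨x, a, hx⟩ := exists_sq q n d hq (by omega) hqn
      (jac1 (n * d) q h4 (by omega) (hmD.trans hqD))
    obtain ⟨k, hk⟩ := hqD
    push_cast at hk
    have hA : (n : ℤ) * (p * k) - 1 ^ 2 = q := by linear_combination -hk
    refine ⟨_, _, _, _, _, _, good_of d p n 1 k a x (by omega) (by omega) hp1' ?_ ?_⟩
    · rw [hA]; exact_mod_cast hq.pos
    · rw [hA]; linear_combination -hx
  · obtain ⟨w, hw⟩ : ∃ w : ℤ, ((n * p : ℕ) : ℤ) = 2 * w + 1 := ⟨((n * p / 2 : ℕ) : ℤ), by omega⟩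
    obtain ⟨q, hqn, hq, hqD, hq8⟩ := exists_prime_crt (n * p) hD w 1
      (by rw [hw]; exact ⟨-2, 1, by ring⟩) (by norm_num) n
    have hqD2 : ((n * p : ℕ) : ℤ) ∣ 2 * q + 1 := by
      obtain ⟨j, hj⟩ := hqD
      exact ⟨2 * j + 1, by linear_combination 2 * hj - hw⟩
    obtain ⟨x, hx⟩ := exists_sq q n d hq (by omega) hqn
      (jac2 (n * d) q (by omega) (by omega) (Or.inl (by
        obtain ⟨j, hj⟩ := hmD.trans hqD2
        exact ⟨2 * j, by linear_combination 2 * hj⟩)))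
    obtain ⟨x, hxo, a, hx⟩ : ∃ x : ℤ, x % 2 = 1 ∧ (q : ℤ) ∣ d + n * x ^ 2 := by
      rcases Int.emod_two_eq_zero_or_one x with h | h
      · refine ⟨x + q, by omega, ?_⟩
        obtain ⟨j, hj⟩ := hx
        exact ⟨j + n * (2 * x + q), by linear_combination hj⟩
      · exact ⟨x, h, hx⟩
    have ha : a % 2 = 0 := by
      have h1 : ((d : ℤ) + n * x ^ 2) % 2 = 0 := by
        have hn' : (n : ℤ) % 2 = 1 := by omega
        have hd' : (d : ℤ) % 2 = 1 := by omega
        simp [Int.add_emod, Int.mul_emod, pow_two, hn', hd', hxo]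
      rw [hx, Int.mul_emod, (by omega : (q : ℤ) % 2 = 1)] at h1
      omega
    obtain ⟨a', rfl⟩ : (2 : ℤ) ∣ a := Int.dvd_of_emod_eq_zero ha
    obtain ⟨k, hk⟩ := hqD2
    push_cast at hk
    have hA : (n : ℤ) * (p * k) - 1 ^ 2 = 2 * q := by linear_combination -hk
    refine ⟨_, _, _, _, _, _, good_of d p n 1 k a' x (by omega) (by omega) hp1' ?_ ?_⟩
    · rw [hA]; have := hq.pos; omega
    · rw [hA]; linear_combination -hx

/-- Exactly one of `n` and `d` is even. -/
lemma exists_good_mixed (d p n D m : ℕ) (hp1 : 1 < p) (hd : 0 < d) (hn : 0 < n)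
    (hD : D % 2 = 1) (hm : m % 2 = 1) (hnD : n * p ∣ 2 * D) (hmD : m ∣ D) (hnd : n * d = 2 * m) :
    ∃ a b c r s t : ℤ, Good d p n a b c r s t := by
  have hp1' : ¬ (p : ℤ) ∣ 1 := by
    intro h
    have := Int.le_of_dvd one_pos h
    omega
  obtain ⟨q, hqn, hq, hqD, hq8⟩ := exists_prime_crt D hD (-1) 3 (coprime_neg_one _)
    (by norm_num) n
  rw [sub_neg_eq_add] at hqD
  obtain ⟨x, a, hx⟩ := exists_sq q n d hq hn hqn (by
    rw [hnd]
    exact jac3 m q hm (by omega) ((Int.natCast_dvd_natCast.2 hmD).trans hqD))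
  have hqD2 : ((n * p : ℕ) : ℤ) ∣ q + 1 := by
    refine (Int.natCast_dvd_natCast.2 hnD).trans ?_
    push_cast
    refine IsCoprime.mul_dvd ⟨-((D / 2 : ℕ) : ℤ), 1, by omega⟩ (by omega) hqD
  obtain ⟨k, hk⟩ := hqD2
  push_cast at hk
  have hA : (n : ℤ) * (p * k) - 1 ^ 2 = q := by linear_combination -hk
  refine ⟨_, _, _, _, _, _, good_of d p n 1 k a x (by omega) (by omega) hp1' ?_ ?_⟩
  · rw [hA]; exact_mod_cast hq.pos
  · rw [hA]; linear_combination -hx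

/-- Both even: `2 d` and `2 n`, with `d`, `n` odd. -/
lemma exists_good_even_even (d p n : ℕ) (hp : p % 2 = 1) (hp1 : 1 < p) (hdp : d ∣ p)
    (hn : n % 2 = 1) (hm : (n * d) % 8 ≠ 7) :
    ∃ a b c r s t : ℤ, Good (2 * d : ℕ) p (2 * n : ℕ) a b c r s t := by
  have hd : d % 2 = 1 := by
    obtain ⟨e, rfl⟩ := hdp
    rcases Nat.mod_two_eq_zero_or_one d with h | h
    · simp [Nat.mul_mod, h] at hp
    · exact h
  have hD : (n * p) % 2 = 1 := by simp [Nat.mul_mod, hn, hp]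
  have hm2 : (n * d) % 2 = 1 := by simp [Nat.mul_mod, hn, hd]
  have hmD : ((n * d : ℕ) : ℤ) ∣ ((n * p : ℕ) : ℤ) := by exact_mod_cast Nat.mul_dvd_mul_left n hdp
  by_cases h4 : (n * d) % 4 = 1
  · have hp1' : ¬ (p : ℤ) ∣ 1 := by
      intro h
      have := Int.le_of_dvd one_pos h
      omega
    obtain ⟨q, hqn, hq, hqD, hq8⟩ := exists_prime_crt (n * p) hD (-1) 1 (coprime_neg_one _)
      (by norm_num) n
    rw [sub_neg_eq_add] at hqD
    obtain ⟨x, a, hx⟩ := exists_sq q n d hq (by omega) hqn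
      (jac1 (n * d) q h4 (by omega) (hmD.trans hqD))
    have hqD2 : 2 * ((n * p : ℕ) : ℤ) ∣ q + 1 :=
      IsCoprime.mul_dvd ⟨-((n * p / 2 : ℕ) : ℤ), 1, by omega⟩ (by omega) hqD
    obtain ⟨k, hk⟩ := hqD2
    push_cast at hk
    have hA : ((2 * n : ℕ) : ℤ) * (p * k) - 1 ^ 2 = q := by push_cast; linear_combination -hk
    refine ⟨_, _, _, _, _, _, good_of (2 * d : ℕ) p (2 * n : ℕ) 1 k (2 * a) x (by omega) (by omega)
      hp1' ?_ ?_⟩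
    · rw [hA]; exact_mod_cast hq.pos
    · rw [hA]; push_cast; linear_combination -2 * hx
  · have hp1' : ¬ (p : ℤ) ∣ 2 := by
      intro h
      have := Int.le_of_dvd two_pos h
      omega
    obtain ⟨q, hqn, hq, hqD, hq8⟩ := exists_prime_crt (n * p) hD (-2) 1 (coprime_neg_two _ hD)
      (by norm_num) n
    rw [sub_neg_eq_add] at hqD
    obtain ⟨x, a, hx⟩ := exists_sq q n d hq (by omega) hqn
      (jac2 (n * d) q (by omega) (by omega) (Or.inr (hmD.trans hqD)))
    obtain ⟨k, hk⟩ := hqD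
    push_cast at hk
    have hA : ((2 * n : ℕ) : ℤ) * (p * k) - 2 ^ 2 = 2 * q := by push_cast; linear_combination -2 * hk
    refine ⟨_, _, _, _, _, _, good_of (2 * d : ℕ) p (2 * n : ℕ) 2 k a x (by omega) (by omega)
      hp1' ?_ ?_⟩
    · rw [hA]; have := hq.pos; omega
    · rw [hA]; push_cast; linear_combination -2 * hx

/-- Odd determinant. -/
lemma exists_good_odd (d p n : ℕ) (hp : p % 2 = 1) (hp1 : 1 < p) (hdp : d ∣ p)
    (hn : n % 4 ≠ 0) (hm : (n * d) % 8 ≠ 7) :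
    ∃ a b c r s t : ℤ, Good d p n a b c r s t := by
  rcases Nat.mod_two_eq_zero_or_one n with h | h
  · obtain ⟨n', rfl⟩ : 2 ∣ n := Nat.dvd_of_mod_eq_zero h
    have hn' : n' % 2 = 1 := by omega
    have hd : d % 2 = 1 := by
      obtain ⟨e, rfl⟩ := hdp
      rcases Nat.mod_two_eq_zero_or_one d with h | h
      · simp [Nat.mul_mod, h] at hp
      · exact h
    exact exists_good_mixed d p (2 * n') (n' * p) (n' * d) hp1 (by omega) (by omega)
      (by simp [Nat.mul_mod, hn', hp]) (by simp [Nat.mul_mod, hn', hd])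
      (by rw [mul_assoc]) (Nat.mul_dvd_mul_left _ hdp) (by ring)
  · exact exists_good_odd_odd d p n hp hp1 hdp h hm

/-- Even determinant `2 d`, with `d` odd. -/
lemma exists_good_even (d p n : ℕ) (hp : p % 2 = 1) (hp1 : 1 < p) (hdp : d ∣ p)
    (hn : n % 4 ≠ 0) (hm : (n * d) % 16 ≠ 14) :
    ∃ a b c r s t : ℤ, Good (2 * d : ℕ) p n a b c r s t := by
  have hd : d % 2 = 1 := by
    obtain ⟨e, rfl⟩ := hdp
    rcases Nat.mod_two_eq_zero_or_one d with h | h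
    · simp [Nat.mul_mod, h] at hp
    · exact h
  rcases Nat.mod_two_eq_zero_or_one n with h | h
  · obtain ⟨n', rfl⟩ : 2 ∣ n := Nat.dvd_of_mod_eq_zero h
    rw [mul_assoc] at hm
    exact exists_good_even_even d p n' hp hp1 hdp (by omega) (by omega)
  · exact exists_good_mixed (2 * d) p n (n * p) (n * d) hp1 (by omega) (by omega)
      (by simp [Nat.mul_mod, h, hp]) (by simp [Nat.mul_mod, h, hd])
      (Dvd.intro_left _ rfl) (Nat.mul_dvd_mul_left _ hdp) (by ring)

/-! ### The seven forms -/

lemma rep1 (n : ℕ) (hn : n % 4 ≠ 0) (h : n % 8 ≠ 7) : ∃ x y z, qv 1 1 1 0 0 0 x y z = n := by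
  obtain ⟨_, _, _, _, _, _, hG⟩ := exists_good_odd 1 3 n (by norm_num) (by norm_num) (by norm_num)
    hn (by omega)
  exact class1 (by exact_mod_cast hG)

lemma rep2 (n : ℕ) (hn : n % 4 ≠ 0) (h : n % 16 ≠ 14) : ∃ x y z, qv 1 1 2 0 0 0 x y z = n := by
  obtain ⟨_, _, _, _, _, _, hG⟩ := exists_good_even 1 3 n (by norm_num) (by norm_num) (by norm_num)
    hn (by omega)
  exact class2 (by exact_mod_cast hG)

lemma rep3 (n : ℕ) (hn : n % 4 ≠ 0) (h : n % 8 ≠ 5) : ∃ x y z, qv 1 2 2 1 0 0 x y z = n := by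
  obtain ⟨_, _, _, _, _, _, hG⟩ := exists_good_odd 3 3 n (by norm_num) (by norm_num) (by norm_num)
    hn (by omega)
  exact class3 (by exact_mod_cast hG)

lemma rep5 (n : ℕ) (hn : n % 4 ≠ 0) (h : n % 8 ≠ 3) : ∃ x y z, qv 1 1 5 0 0 0 x y z = n := by
  obtain ⟨_, _, _, _, _, _, hG⟩ := exists_good_odd 5 5 n (by norm_num) (by norm_num) (by norm_num)
    hn (by omega)
  exact class5 (by exact_mod_cast hG)

lemma rep6 (n : ℕ) (hn : n % 4 ≠ 0) (h : n % 16 ≠ 10) : ∃ x y z, qv 1 2 3 0 0 0 x y z = n := by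
  obtain ⟨_, _, _, _, _, _, hG⟩ := exists_good_even 3 3 n (by norm_num) (by norm_num) (by norm_num)
    hn (by omega)
  exact class6 (by exact_mod_cast hG)

lemma rep7 (n : ℕ) (hn : n % 4 ≠ 0) (h : n % 8 ≠ 1) : ∃ x y z, qv 2 2 3 1 1 1 x y z = n := by
  obtain ⟨_, _, _, _, _, _, hG⟩ := exists_good_odd 7 7 n (by norm_num) (by norm_num) (by norm_num)
    hn (by omega)
  exact class7 (by exact_mod_cast hG)

lemma rep14 (n : ℕ) (hn : n % 4 ≠ 0) (h : n % 16 ≠ 2) : ∃ x y z, qv 1 3 5 1 0 0 x y z = n := by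
  obtain ⟨_, _, _, _, _, _, hG⟩ := exists_good_even 7 7 n (by norm_num) (by norm_num) (by norm_num)
    hn (by omega)
  exact class14 (by exact_mod_cast hG)

/-! ### Assembling -/

lemma qv_eq (a b c r s t : ℤ) (x : Fin 3 → ℤ) :
    x ⬝ᵥ (!![a, t, s; t, b, r; s, r, c] : Matrix (Fin 3) (Fin 3) ℤ).mulVec x
      = qv a b c r s t (x 0) (x 1) (x 2) := by
  simp [dotProduct, Matrix.mulVec, Fin.sum_univ_three, qv]
  ring

lemma isPD (a b c r s t : ℤ) (ha : 0 < a) (hP : 0 < a * b - t ^ 2)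
    (hd : 0 < a * b * c + 2 * r * s * t - a * r ^ 2 - b * s ^ 2 - c * t ^ 2) :
    IsPDForm (!![a, t, s; t, b, r; s, r, c] : Matrix (Fin 3) (Fin 3) ℤ) := by
  refine ⟨?_, ?_⟩
  · ext i j
    fin_cases i <;> fin_cases j <;> rfl
  · intro v hv
    rw [qv_eq]
    generalize hx : v 0 = x
    generalize hy : v 1 = y
    generalize hz : v 2 = z
    by_contra hcon
    have key : (a * b - t ^ 2) * (a * qv a b c r s t x y z) =
        (a * b - t ^ 2) * (a * x + t * y + s * z) ^ 2
        + ((a * b - t ^ 2) * y + (a * r - s * t) * z) ^ 2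
        + a * (a * b * c + 2 * r * s * t - a * r ^ 2 - b * s ^ 2 - c * t ^ 2) * z ^ 2 := by
      unfold qv; ring
    have hle : (a * b - t ^ 2) * (a * qv a b c r s t x y z) ≤ 0 :=
      mul_nonpos_of_nonneg_of_nonpos hP.le
        (mul_nonpos_of_nonneg_of_nonpos ha.le (not_lt.1 hcon))
    have n1 : 0 ≤ (a * b - t ^ 2) * (a * x + t * y + s * z) ^ 2 := by positivity
    have n2 : 0 ≤ ((a * b - t ^ 2) * y + (a * r - s * t) * z) ^ 2 := by positivity
    have hc := mul_pos ha hd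
    have n3 := mul_nonneg hc.le (sq_nonneg z)
    have z1 : z = 0 := by
      have : a * (a * b * c + 2 * r * s * t - a * r ^ 2 - b * s ^ 2 - c * t ^ 2) * z ^ 2 = 0 := by
        linarith
      simpa [hc.ne'] using this
    subst z1
    have y1 : y = 0 := by
      have : ((a * b - t ^ 2) * y + (a * r - s * t) * 0) ^ 2 = 0 := by linarith
      simpa [hP.ne'] using this
    subst y1
    have x1 : x = 0 := by
      have : (a * b - t ^ 2) * (a * x + t * 0 + s * 0) ^ 2 = 0 := by linarith
      simpa [hP.ne', ha.ne'] using this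
    subst x1
    apply hv
    ext i
    fin_cases i <;> assumption

lemma conclude (a b c r s t : ℤ) (ha : 0 < a) (hP : 0 < a * b - t ^ 2)
    (hd : 0 < a * b * c + 2 * r * s * t - a * r ^ 2 - b * s ^ 2 - c * t ^ 2)
    (A e n : Fin 6 → ℕ) (hA : ∀ i, A i = 4 ^ e i * n i)
    (h : ∀ i, ∃ x y z, qv a b c r s t x y z = n i) :
    ∃ M : Matrix (Fin 3) (Fin 3) ℤ, IsPDForm M ∧ ∀ i, RepresentsInt M (A i : ℤ) := by
  refine ⟨_, isPD a b c r s t ha hP hd, fun i => ?_⟩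
  obtain ⟨x, y, z, hx⟩ := h i
  refine ⟨![2 ^ e i * x, 2 ^ e i * y, 2 ^ e i * z], ?_⟩
  rw [qv_eq, hA i]
  push_cast
  rw [← hx, show (4 : ℤ) ^ e i = 2 ^ e i * 2 ^ e i by rw [← mul_pow]; norm_num]
  simp [qv]
  ring

/-- The index of the form missing the class of `b` (or `7`). -/
def lab (b : ℕ) : ℕ :=
  if b % 8 = 7 then 0 else if b % 16 = 14 then 1 else if b % 8 = 5 then 2 else
  if b % 8 = 3 then 3 else if b % 16 = 10 then 4 else if b % 8 = 1 then 5 else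
  if b % 16 = 2 then 6 else 7

/-- Any six positive integers are simultaneously represented by some positive definite
integral ternary quadratic form: κ(1,3) ≥ 6. -/
theorem six_integers_represented (a : Fin 6 → ℕ) (ha : ∀ i, 0 < a i) :
    ∃ M : Matrix (Fin 3) (Fin 3) ℤ, IsPDForm M ∧ ∀ i, RepresentsInt M (a i : ℤ) := by
  have hdec : ∀ i, ∃ e n : ℕ, a i = 4 ^ e * n ∧ n % 4 ≠ 0 := by
    intro i
    obtain ⟨e, n, h1, h2⟩ := Nat.exists_eq_pow_mul_and_not_dvd (ha i).ne' 4 (by norm_num)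
    exact ⟨e, n, h2, by omega⟩
  choose e n hA hn using hdec
  have hpig : ∃ j : Fin 7, ∀ i, lab (n i) ≠ j := by
    by_contra hcon
    push Not at hcon
    choose g hg using hcon
    have hinj : Function.Injective g := by
      intro j k hjk
      apply Fin.ext
      rw [← hg j, ← hg k, hjk]
    have := Fintype.card_le_of_injective g hinj
    simp at this
  obtain ⟨j, hj⟩ := hpig
  fin_cases j
  · refine conclude 1 1 1 0 0 0 (by norm_num) (by norm_num) (by norm_num) a e n hA
      fun i => rep1 _ (hn i) ?_
    have := hj i; simp only [lab] at this; split_ifs at this <;> simp at this <;> omega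
  · refine conclude 1 1 2 0 0 0 (by norm_num) (by norm_num) (by norm_num) a e n hA
      fun i => rep2 _ (hn i) ?_
    have := hj i; simp only [lab] at this; split_ifs at this <;> simp at this <;> omega
  · refine conclude 1 2 2 1 0 0 (by norm_num) (by norm_num) (by norm_num) a e n hA
      fun i => rep3 _ (hn i) ?_
    have := hj i; simp only [lab] at this; split_ifs at this <;> simp at this <;> omega
  · refine conclude 1 1 5 0 0 0 (by norm_num) (by norm_num) (by norm_num) a e n hA
      fun i => rep5 _ (hn i) ?_
    have := hj i; simp only [lab] at this; split_ifs at this <;> simp at this <;> omega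
  · refine conclude 1 2 3 0 0 0 (by norm_num) (by norm_num) (by norm_num) a e n hA
      fun i => rep6 _ (hn i) ?_
    have := hj i; simp only [lab] at this; split_ifs at this <;> simp at this <;> omega
  · refine conclude 2 2 3 1 1 1 (by norm_num) (by norm_num) (by norm_num) a e n hA
      fun i => rep7 _ (hn i) ?_
    have := hj i; simp only [lab] at this; split_ifs at this <;> simp at this <;> omega
  · refine conclude 1 3 5 1 0 0 (by norm_num) (by norm_num) (by norm_num) a e n hA
      fun i => rep14 _ (hn i) ?_
    have := hj i; simp only [lab] at this; split_ifs at this <;> simp at this <;> omega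
end

section
/- For any seven even positive integers a₁,…,a₇, there exists a positive definite integral ternary quadratic form that represents all seven of them. -/
open Matrix

open NumberTheorySymbols in
theorem jac_flip {B q : ℕ} (hB : B % 2 = 1) (hq : q % 2 = 1) :
    J(B | q) = (if B % 4 = 3 ∧ q % 4 = 3 then -1 else 1) * J(q | B) := by
  rw [jacobiSym.quadratic_reciprocity_if hB hq |>.symm]
  split_ifs <;> simp

open NumberTheorySymbols in
theorem jac_chi4 {b : ℕ} (hb : b % 2 = 1) : J(-1 | b) = if b % 4 = 1 then 1 else -1 := by
  rw [jacobiSym.at_neg_one (Nat.odd_iff.2 hb), ZMod.χ₄_nat_eq_if_mod_four]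
  simp [hb]

open NumberTheorySymbols in
theorem jac_chi8 {b : ℕ} (hb : b % 2 = 1) :
    J(2 | b) = if b % 8 = 1 ∨ b % 8 = 7 then 1 else -1 := by
  rw [jacobiSym.at_two (Nat.odd_iff.2 hb), ZMod.χ₈_nat_eq_if_mod_eight]
  simp [hb]

open NumberTheorySymbols in
theorem jac1_s7 {d e q b n : ℕ} (hd : d = 3 ∨ d = 5 ∨ d = 7) (hq : q % 2 = 1)
    (hbd : b % d = d - 1) (h : e * q + d = b * n)
    (hc : (e = 1 ∧ n % 4 = 2 ∧ b % 8 = 1) ∨ (e = 2 ∧ b % 8 = 1 ∧ (n * d) % 8 = 3) ∨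
      (e = 2 ∧ b % 8 = 3 ∧ (n * d) % 4 = 1)) : J(-b | q) = 1 := by
  have hb : b % 2 = 1 := by omega
  have hd2 : d % 2 = 1 := by omega
  have h1 : J(-b | q) = J(-1 | q) * J(b | q) := by
    rw [← jacobiSym.mul_left]; simp
  have h2 : J(e | b) * J(q | b) = J(-1 | b) * J(d | b) := by
    rw [← jacobiSym.mul_left, ← jacobiSym.mul_left]
    apply jacobiSym.mod_left'
    have : (e * q : ℤ) = -1 * d + b * n := by
      have : (e * q + d : ℤ) = b * n := by exact_mod_cast h
      linarith
    rw [this, Int.add_mul_emod_self_left]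
  have h3 : J(b | d) = J(-1 | d) := by
    apply jacobiSym.mod_left'
    rcases hd with rfl | rfl | rfl <;> omega
  rw [jac_flip hd2 hb, h3, jac_chi4 hb, jac_chi4 hd2] at h2
  rw [h1, jac_flip hb hq, jac_chi4 hq]
  have hmod : (e * q + d) % 8 = ((b % 8) * (n % 8)) % 8 := by rw [h, Nat.mul_mod]
  have hn : n % 8 < 8 := Nat.mod_lt _ (by norm_num)
  rcases hc with ⟨rfl, hn4, hb8⟩ | ⟨rfl, hb8, hnd⟩ | ⟨rfl, hb8, hnd⟩
  · have hb4 : b % 4 = 1 := by omega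
    rw [hb8] at hmod
    simp [hb4] at h2 ⊢
    rw [h2]
    rcases hd with rfl | rfl | rfl <;> simp <;> omega
  · have hb4 : b % 4 = 1 := by omega
    rw [hb8] at hmod
    have h8 := jac_chi8 hb
    simp [hb8] at h8
    simp [hb4, h8] at h2 ⊢
    rw [h2]
    rcases hd with rfl | rfl | rfl <;> simp <;> omega
  · have hb4 : b % 4 = 3 := by omega
    rw [hb8] at hmod
    have h8 := jac_chi8 hb
    simp [hb8] at h8
    simp [hb4, h8] at h2 ⊢
    have h5 : J(q | b) = 1 := by
      rcases hd with rfl | rfl | rfl <;> simp at h2 <;> linarith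
    have : q % 4 = 1 ∨ q % 4 = 3 := by omega
    rcases this with h | h <;> simp [h, h5]

open NumberTheorySymbols in
theorem jac2_s7 {d e q b n : ℕ} (hd : d = 1 ∨ d = 3 ∨ d = 5 ∨ d = 7) (hq : q % 2 = 1)
    (hdn : d ∣ n) (h : e * q + 1 = b * n)
    (hc : (e = 1 ∧ n % 4 = 2 ∧ (b * d) % 8 = 1) ∨ (e = 2 ∧ (b * d) % 8 = 1 ∧ (n * d) % 8 = 3) ∨
      (e = 2 ∧ (b * d) % 8 = 3 ∧ (n * d) % 4 = 1)) : J(-(b * d : ℕ) | q) = 1 := by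
  have hb : b % 2 = 1 := by rcases hd with rfl | rfl | rfl | rfl <;> omega
  have hd2 : d % 2 = 1 := by omega
  have h1 : J(-(b * d : ℕ) | q) = J(-1 | q) * (J(b | q) * J(d | q)) := by
    rw [← jacobiSym.mul_left, ← jacobiSym.mul_left]; simp
  have key : ∀ c : ℕ, c ∣ b * n → J(e | c) * J(q | c) = J(-1 | c) := by
    intro c hcn
    obtain ⟨k, hk⟩ := hcn
    rw [← jacobiSym.mul_left]
    apply jacobiSym.mod_left'
    have : (e * q : ℤ) = -1 + c * k := by
      have : (e * q + 1 : ℤ) = c * k := by exact_mod_cast h.trans hk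
      linarith
    rw [this, Int.add_mul_emod_self_left]
  have h2 := key b (Dvd.intro _ rfl)
  have h3 := key d (hdn.mul_left b)
  rw [jac_chi4 hb] at h2
  rw [jac_chi4 hd2] at h3
  rw [h1, jac_flip hb hq, jac_flip hd2 hq, jac_chi4 hq]
  have hmod : (e * q + 1) % 8 = ((b % 8) * (n % 8)) % 8 := by rw [h, Nat.mul_mod]
  have hn : n % 8 < 8 := Nat.mod_lt _ (by norm_num)
  have h8 := jac_chi8 hb
  have h8d := jac_chi8 hd2
  have hq4 : q % 4 = 1 ∨ q % 4 = 3 := by omega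
  have hb9 : b % 8 = 1 ∨ b % 8 = 3 ∨ b % 8 = 5 ∨ b % 8 = 7 := by omega
  have hb4 : b % 4 = (b % 8) % 4 := by omega
  rcases hc with ⟨rfl, hn4, hb8⟩ | ⟨rfl, hb8, hnd⟩ | ⟨rfl, hb8, hnd⟩ <;>
  rcases hd with rfl | rfl | rfl | rfl <;>
  rcases hb9 with hb9 | hb9 | hb9 | hb9 <;>
  first
  | (exfalso; omega)
  | (rw [hb9] at hb4 hmod h8
     simp at hb4 h8 h8d
     simp [hb4, h8, h8d] at h2 h3 ⊢
     rcases hq4 with h | h <;> first | (exfalso; omega) | (simp_all; done) |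
       (rw [neg_eq_iff_eq_neg] at h2 h3; simp_all))

theorem dir {e c b0 n a0 m : ℕ} (h : e * a0 + c = b0 * n) (hm : m * n ≠ 0)
    (hc : a0.Coprime (m * n)) :
    ∃ q k, q.Prime ∧ 100 < q ∧ e * q + c = (b0 + e * m * k) * n := by
  obtain ⟨p, hp, hpp, hmod⟩ := Nat.forall_exists_prime_gt_and_modEq (100 + a0) hm hc
  obtain ⟨k, hk⟩ := (Nat.modEq_iff_dvd' (by omega)).1 hmod.symm
  refine ⟨p, k, hpp, by omega, ?_⟩
  have : p = a0 + m * n * k := by omega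
  rw [this]
  linear_combination h

open NumberTheorySymbols in
theorem root {q d B : ℕ} (hq : q.Prime) (hq2 : q % 2 = 1) (hqd : q.Coprime d) (hd : d % 2 = 1)
    (hJ : J(-B | q) = 1) : ∃ z : ℤ, (q : ℤ) ∣ z ^ 2 + B ∧ (d : ℤ) ∣ z ∧ z % 2 = 1 := by
  have := Fact.mk hq
  obtain ⟨y, hy⟩ := ZMod.isSquare_of_jacobiSym_eq_one hJ
  obtain ⟨z0, rfl⟩ := ZMod.intCast_surjective y
  have h0 : (q : ℤ) ∣ z0 ^ 2 + B := by
    rw [← ZMod.intCast_zmod_eq_zero_iff_dvd]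
    push_cast at hy ⊢
    linear_combination -hy
  have hco : IsCoprime (q : ℤ) ((2 * d : ℕ) : ℤ) := by
    rw [Nat.isCoprime_iff_coprime]
    exact Nat.Coprime.mul_right (Nat.odd_iff.2 hq2).coprime_two_right hqd
  obtain ⟨u, v, huv⟩ := hco
  push_cast at huv
  refine ⟨z0 * (v * (2 * d)) + d * (u * q), ?_, ?_, ?_⟩
  · have e1 : v * (2 * d) = 1 - u * q := by linarith
    rw [e1]
    obtain ⟨w, hw⟩ := h0
    refine ⟨w + (z0*u*(-2)*z0 + 2 * z0 * d * u) + q * (d * u - z0 * u)^2, ?_⟩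
    linear_combination hw
  · exact ⟨z0 * (v * 2) + u * q, by ring⟩
  · have e1 : (u * q) % 2 = 1 := by
      have : u * q = 1 - 2 * (v * d) := by linarith
      omega
    have e2 : (d * (u * q)) % 2 = 1 := by
      rw [Int.mul_emod, e1]; omega
    have : z0 * (v * (2 * d)) = 2 * (z0 * v * d) := by ring
    omega

/-- Value of the ternary form with diagonal `a b c` and off-diagonal `r s t`. -/
def tf (a b c r s t x y z : ℤ) : ℤ :=
  a * x ^ 2 + b * y ^ 2 + c * z ^ 2 + 2 * r * y * z + 2 * s * x * z + 2 * t * x * y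

/-- Gram matrix of the ternary form with diagonal `a b c` and off-diagonal `r s t`. -/
def tmat (a b c r s t : ℤ) : Matrix (Fin 3) (Fin 3) ℤ := !![a, t, s; t, b, r; s, r, c]

theorem tmat_val (a b c r s t x y z : ℤ) :
    ![x, y, z] ⬝ᵥ (tmat a b c r s t).mulVec ![x, y, z] = tf a b c r s t x y z := by
  simp [tmat, tf, dotProduct, Matrix.mulVec, Fin.sum_univ_three]; ring

theorem vec3_eta (v : Fin 3 → ℤ) : ![v 0, v 1, v 2] = v := by
  ext i; fin_cases i <;> rfl

theorem tmat_rep (a b c r s t n : ℤ) :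
    RepresentsInt (tmat a b c r s t) n ↔ ∃ x y z, tf a b c r s t x y z = n := by
  constructor
  · rintro ⟨v, hv⟩
    refine ⟨v 0, v 1, v 2, ?_⟩
    rw [← tmat_val, vec3_eta, hv]
  · rintro ⟨x, y, z, h⟩
    exact ⟨![x, y, z], by rw [tmat_val, h]⟩

theorem tmat_det (a b c r s t : ℤ) :
    (tmat a b c r s t).det = a * b * c + 2 * r * s * t - a * r ^ 2 - b * s ^ 2 - c * t ^ 2 := by
  simp [tmat, Matrix.det_fin_three]; ring

theorem symm_eq_tmat {M : Matrix (Fin 3) (Fin 3) ℤ} (h : M.IsSymm) :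
    M = tmat (M 0 0) (M 1 1) (M 2 2) (M 1 2) (M 0 2) (M 0 1) := by
  have h1 := h.apply 0 1
  have h2 := h.apply 0 2
  have h3 := h.apply 1 2
  ext i j
  fin_cases i <;> fin_cases j <;> simp [tmat, h1, h2, h3]

theorem tmat_pd {a b c r s t : ℤ} (ha : 0 < a) (hm : 0 < a * b - t ^ 2)
    (hd : 0 < a * b * c + 2 * r * s * t - a * r ^ 2 - b * s ^ 2 - c * t ^ 2) :
    IsPDForm (tmat a b c r s t) := by
  constructor
  · unfold Matrix.IsSymm
    ext i j
    fin_cases i <;> fin_cases j <;> rfl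
  · intro v hv
    rw [← vec3_eta v, tmat_val]
    set x := v 0 with hx
    set y := v 1 with hy
    set z := v 2 with hz
    by_contra hcon
    push Not at hcon
    set m := a * b - t ^ 2 with hmdef
    set D := a * b * c + 2 * r * s * t - a * r ^ 2 - b * s ^ 2 - c * t ^ 2 with hD
    have id : a * m * tf a b c r s t x y z = m * (a * x + t * y + s * z) ^ 2 +
        (m * y + (a * r - s * t) * z) ^ 2 + a * D * z ^ 2 := by
      simp only [tf, hmdef, hD]; ring
    have h1 : a * m * tf a b c r s t x y z ≤ 0 :=
      mul_nonpos_of_nonneg_of_nonpos (by positivity) hcon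
    have p1 : 0 ≤ m * (a * x + t * y + s * z) ^ 2 := by positivity
    have p2 : 0 ≤ (m * y + (a * r - s * t) * z) ^ 2 := by positivity
    have p3 : 0 ≤ a * D * z ^ 2 := by positivity
    have q3 : a * D * z ^ 2 = 0 := by linarith
    have hz0 : z = 0 := by
      rcases mul_eq_zero.1 q3 with h | h
      · exact absurd h (by positivity)
      · exact pow_eq_zero_iff (two_ne_zero) |>.1 h
    have q2 : (m * y + (a * r - s * t) * z) ^ 2 = 0 := by linarith
    have hy0 : y = 0 := by
      have := pow_eq_zero_iff (two_ne_zero) |>.1 q2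
      rw [hz0] at this
      have h : m * y = 0 := by linarith
      rcases mul_eq_zero.1 h with h | h
      · omega
      · exact h
    have q1 : m * (a * x + t * y + s * z) ^ 2 = 0 := by linarith
    have hx0 : x = 0 := by
      rcases mul_eq_zero.1 q1 with h | h
      · omega
      · have := pow_eq_zero_iff (two_ne_zero) |>.1 h
        rw [hz0, hy0] at this
        have h : a * x = 0 := by linarith
        rcases mul_eq_zero.1 h with h | h
        · omega
        · exact h
    apply hv
    rw [← vec3_eta v, ← hx, ← hy, ← hz, hx0, hy0, hz0]
    ext i; fin_cases i <;> rfl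

/-- Isotropy modulo `p` outside the radical. -/
def Iso (p : ℕ) (M : Matrix (Fin 3) (Fin 3) ℤ) : Prop :=
  ∃ v : Fin 3 → ℤ, (p : ℤ) ∣ v ⬝ᵥ M.mulVec v ∧ ¬ ∀ i, (p : ℤ) ∣ M.mulVec v i

/-- Integral equivalence with an explicit inverse. -/
def Eqv (M N : Matrix (Fin 3) (Fin 3) ℤ) : Prop :=
  ∃ U V : Matrix (Fin 3) (Fin 3) ℤ, U * V = 1 ∧ V * U = 1 ∧ N = Uᵀ * M * U

theorem Eqv.refl (M : Matrix (Fin 3) (Fin 3) ℤ) : Eqv M M := ⟨1, 1, by simp, by simp, by simp⟩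

theorem Eqv.trans {M N K : Matrix (Fin 3) (Fin 3) ℤ} (h : Eqv M N) (h' : Eqv N K) : Eqv M K := by
  obtain ⟨U, V, h1, h2, rfl⟩ := h
  obtain ⟨U', V', h1', h2', rfl⟩ := h'
  refine ⟨U * U', V' * V, ?_, ?_, ?_⟩
  · rw [Matrix.mul_assoc, ← Matrix.mul_assoc U' V', h1', Matrix.one_mul, h1]
  · rw [Matrix.mul_assoc, ← Matrix.mul_assoc V U, h2, Matrix.one_mul, h2']
  · simp only [Matrix.transpose_mul, Matrix.mul_assoc]

theorem congr_val (M U : Matrix (Fin 3) (Fin 3) ℤ) (v : Fin 3 → ℤ) :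
    v ⬝ᵥ (Uᵀ * M * U).mulVec v = (U.mulVec v) ⬝ᵥ M.mulVec (U.mulVec v) := by
  rw [← Matrix.mulVec_mulVec, ← Matrix.mulVec_mulVec, Matrix.dotProduct_mulVec,
    Matrix.vecMul_transpose]

theorem Eqv.pd {M N : Matrix (Fin 3) (Fin 3) ℤ} (h : Eqv M N) (hM : IsPDForm M) : IsPDForm N := by
  obtain ⟨U, V, h1, h2, rfl⟩ := h
  constructor
  · have := hM.1
    unfold Matrix.IsSymm at *
    simp [Matrix.transpose_mul, this, Matrix.mul_assoc]
  · intro v hv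
    rw [congr_val]
    apply hM.2
    intro h0
    apply hv
    have : (V * U).mulVec v = 0 := by rw [← Matrix.mulVec_mulVec, h0, Matrix.mulVec_zero]
    rwa [h2, Matrix.one_mulVec] at this

theorem Eqv.det {M N : Matrix (Fin 3) (Fin 3) ℤ} (h : Eqv M N) : N.det = M.det := by
  obtain ⟨U, V, h1, h2, rfl⟩ := h
  have h3 : U.det * V.det = 1 := by rw [← Matrix.det_mul, h1, Matrix.det_one]
  have h4 : U.det ^ 2 = 1 := by
    rcases Int.isUnit_iff.1 (IsUnit.of_mul_eq_one _ h3) with h | h <;> rw [h] <;> norm_num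
  rw [Matrix.det_mul, Matrix.det_mul, Matrix.det_transpose]
  linear_combination M.det * h4

theorem Eqv.rep {M N : Matrix (Fin 3) (Fin 3) ℤ} (h : Eqv M N) {n : ℤ}
    (hM : RepresentsInt M n) : RepresentsInt N n := by
  obtain ⟨U, V, h1, h2, rfl⟩ := h
  obtain ⟨v, hv⟩ := hM
  refine ⟨V.mulVec v, ?_⟩
  rw [congr_val, Matrix.mulVec_mulVec, h1, Matrix.one_mulVec, hv]

theorem Eqv.iso {M N : Matrix (Fin 3) (Fin 3) ℤ} (h : Eqv M N) {p : ℕ}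
    (hM : Iso p M) : Iso p N := by
  obtain ⟨U, V, h1, h2, rfl⟩ := h
  obtain ⟨v, hv, hv'⟩ := hM
  refine ⟨V.mulVec v, ?_, ?_⟩
  · rwa [congr_val, Matrix.mulVec_mulVec, h1, Matrix.one_mulVec]
  · intro hall
    apply hv'
    intro i
    have e : M.mulVec v = Vᵀ.mulVec ((Uᵀ * M * U).mulVec (V.mulVec v)) := by
      have : Vᵀ * (Uᵀ * M * U) * V = M := by
        have h5 : Vᵀ * Uᵀ = 1 := by rw [← Matrix.transpose_mul, h1, Matrix.transpose_one]
        calc Vᵀ * (Uᵀ * M * U) * V = (Vᵀ * Uᵀ) * M * (U * V) := by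
              simp only [Matrix.mul_assoc]
          _ = M := by rw [h5, h1]; simp
      rw [Matrix.mulVec_mulVec, Matrix.mulVec_mulVec, this]
    rw [e]
    change (p : ℤ) ∣ ∑ j, Vᵀ i j * ((Uᵀ * M * U).mulVec (V.mulVec v)) j
    exact Finset.dvd_sum (fun j _ => Dvd.dvd.mul_left (hall j) _)

theorem diag_pos {M : Matrix (Fin 3) (Fin 3) ℤ} (h : IsPDForm M) (i : Fin 3) : 0 < M i i := by
  have := h.2 (Pi.single i 1) (by simp)
  simpa using this

/-- Trace-minimal representative. -/
theorem exists_min {M : Matrix (Fin 3) (Fin 3) ℤ} (h : IsPDForm M) :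
    ∃ N, Eqv M N ∧ ∀ K, Eqv N K → N.trace ≤ K.trace := by
  have hne : ({N | Eqv M N} : Set (Matrix (Fin 3) (Fin 3) ℤ)).Nonempty := ⟨M, Eqv.refl M⟩
  obtain ⟨N, hN, hmin⟩ := WellFounded.has_min
    (InvImage.wf (fun K : Matrix (Fin 3) (Fin 3) ℤ => K.trace.toNat) wellFounded_lt) _ hne
  refine ⟨N, hN, fun K hK => ?_⟩
  have hMK : Eqv M K := Eqv.trans hN hK
  have := hmin K hMK
  simp only [InvImage] at this
  have pK := hMK.pd h
  have : 0 < K.trace := by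
    rw [Matrix.trace_fin_three]
    have := diag_pos pK 0
    have := diag_pos pK 1
    have := diag_pos pK 2
    linarith
  omega

theorem min_ineq {a b c r s t : ℤ}
    (hmin : ∀ K, Eqv (tmat a b c r s t) K → (tmat a b c r s t).trace ≤ K.trace) (x y : ℤ) :
    0 ≤ a * x ^ 2 + b * y ^ 2 + 2 * t * x * y + 2 * s * x + 2 * r * y ∧
    0 ≤ a * x ^ 2 + c * y ^ 2 + 2 * s * x * y + 2 * t * x + 2 * r * y ∧
    0 ≤ b * x ^ 2 + c * y ^ 2 + 2 * r * x * y + 2 * t * x + 2 * s * y := by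
  refine ⟨?_, ?_, ?_⟩
  · have := hmin _ ⟨!![1, 0, x; 0, 1, y; 0, 0, 1], !![1, 0, -x; 0, 1, -y; 0, 0, 1],
      by ext i j; fin_cases i <;> fin_cases j <;> simp [Matrix.mul_apply, Fin.sum_univ_three],
      by ext i j; fin_cases i <;> fin_cases j <;> simp [Matrix.mul_apply, Fin.sum_univ_three], rfl⟩
    simp [tmat, Matrix.trace_fin_three, Matrix.mul_apply, Fin.sum_univ_three] at this
    linarith
  · have := hmin _ ⟨!![1, x, 0; 0, 1, 0; 0, y, 1], !![1, -x, 0; 0, 1, 0; 0, -y, 1],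
      by ext i j; fin_cases i <;> fin_cases j <;> simp [Matrix.mul_apply, Fin.sum_univ_three],
      by ext i j; fin_cases i <;> fin_cases j <;> simp [Matrix.mul_apply, Fin.sum_univ_three], rfl⟩
    simp [tmat, Matrix.trace_fin_three, Matrix.mul_apply, Fin.sum_univ_three] at this
    linarith
  · have := hmin _ ⟨!![1, 0, 0; x, 1, 0; y, 0, 1], !![1, 0, 0; -x, 1, 0; -y, 0, 1],
      by ext i j; fin_cases i <;> fin_cases j <;> simp [Matrix.mul_apply, Fin.sum_univ_three],
      by ext i j; fin_cases i <;> fin_cases j <;> simp [Matrix.mul_apply, Fin.sum_univ_three], rfl⟩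
    simp [tmat, Matrix.trace_fin_three, Matrix.mul_apply, Fin.sum_univ_three] at this
    linarith

theorem sq_bound {A B R : ℤ} (hA : 0 ≤ A) (hAB : A ≤ B) (h1 : 2 * R ≤ A) (h2 : -A ≤ 2 * R) :
    4 * R ^ 2 ≤ A * B := by nlinarith [mul_nonneg hA (sub_nonneg.2 hAB)]

/-- The case of negative product, up to signs. -/
theorem red_neg {a b c r s t : ℤ} (ha : 0 < a) (hab : a ≤ b) (hbc : b ≤ c)
    (hr : 0 ≤ r) (hs : 0 ≤ s) (ht : 0 ≤ t) (hr2 : 2 * r ≤ b) (hs2 : 2 * s ≤ a) (ht2 : 2 * t ≤ a)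
    (hsum : 2 * (r + s + t) ≤ a + b) :
    a * b * c ≤ 4 * (a * b * c - 2 * r * s * t - a * r ^ 2 - b * s ^ 2 - c * t ^ 2) := by
  have h1 : 4 * t ^ 2 ≤ a * b := sq_bound ha.le hab ht2 (by linarith)
  have h2 : 0 ≤ (c - b) * (3 * (a * b) - 4 * t ^ 2) := by
    apply mul_nonneg <;> nlinarith
  have h3 : 2 * r * (s * t) ≤ b * (s * t) := mul_le_mul_of_nonneg_right hr2 (by positivity)
  have h4 : a * r * (2 * r) ≤ a * r * b := mul_le_mul_of_nonneg_left hr2 (by positivity)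
  have h5 : 4 * s ^ 2 + 4 * t ^ 2 + 4 * (s * t) + 2 * a * r ≤ 3 * a * b := by
    nlinarith [mul_nonneg hs (sub_nonneg.2 hs2), mul_nonneg ht (sub_nonneg.2 ht2),
      mul_nonneg hs (sub_nonneg.2 ht2), mul_nonneg ht (sub_nonneg.2 hs2)]
  have h6 := mul_le_mul_of_nonneg_left h5 (by linarith : (0 : ℤ) ≤ b)
  nlinarith

theorem red_bound {a b c r s t : ℤ} (ha : 0 < a) (hab : a ≤ b) (hbc : b ≤ c)
    (hr : 2 * |r| ≤ b) (hs : 2 * |s| ≤ a) (ht : 2 * |t| ≤ a)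
    (h1 : 0 ≤ a + b + 2 * t + 2 * s + 2 * r) (h2 : 0 ≤ a + b - 2 * t + 2 * s - 2 * r)
    (h3 : 0 ≤ a + b - 2 * t - 2 * s + 2 * r) (h4 : 0 ≤ a + b + 2 * t - 2 * s - 2 * r) :
    a * b * c ≤ 4 * (a * b * c + 2 * r * s * t - a * r ^ 2 - b * s ^ 2 - c * t ^ 2) := by
  by_cases hpos : 0 ≤ r * s * t
  · have e1 : 4 * r ^ 2 ≤ b * c := by
      rw [← sq_abs]; exact sq_bound (by linarith) hbc hr (by linarith [abs_nonneg r])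
    have e2 : 4 * s ^ 2 ≤ a * c := by
      rw [← sq_abs]; exact sq_bound (by linarith) (by linarith) hs (by linarith [abs_nonneg s])
    have e3 : 4 * t ^ 2 ≤ a * b := by
      rw [← sq_abs]; exact sq_bound (by linarith) hab ht (by linarith [abs_nonneg t])
    nlinarith
  · push Not at hpos
    have key := red_neg ha hab hbc (abs_nonneg r) (abs_nonneg s) (abs_nonneg t) hr hs ht
    rcases le_total 0 r with hr0 | hr0 <;> rcases le_total 0 s with hs0 | hs0 <;>
    rcases le_total 0 t with ht0 | ht0 <;>
    simp only [abs_of_nonneg, abs_of_nonpos, hr0, hs0, ht0] at key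
    · nlinarith [mul_nonneg (mul_nonneg hr0 hs0) ht0]
    · have := key (by linarith); nlinarith
    · have := key (by linarith); nlinarith
    · nlinarith [mul_nonneg (mul_nonneg hr0 (neg_nonneg.2 hs0)) (neg_nonneg.2 ht0)]
    · have := key (by linarith); nlinarith
    · nlinarith [mul_nonneg (mul_nonneg (neg_nonneg.2 hr0) hs0) (neg_nonneg.2 ht0)]
    · nlinarith [mul_nonneg (mul_nonneg (neg_nonneg.2 hr0) (neg_nonneg.2 hs0)) ht0]
    · have := key (by linarith); nlinarith

theorem min_bound {a b c r s t : ℤ} (ha : 0 < a) (hb : 0 < b) (hc : 0 < c)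
    (hmin : ∀ K, Eqv (tmat a b c r s t) K → (tmat a b c r s t).trace ≤ K.trace) :
    (2 * |r| ≤ b ∧ 2 * |r| ≤ c ∧ 2 * |s| ≤ a ∧ 2 * |s| ≤ c ∧ 2 * |t| ≤ a ∧ 2 * |t| ≤ b) ∧
    a * b * c ≤ 4 * (a * b * c + 2 * r * s * t - a * r ^ 2 - b * s ^ 2 - c * t ^ 2) := by
  have i1 := min_ineq hmin 1 0
  have i2 := min_ineq hmin (-1) 0
  have i3 := min_ineq hmin 0 1
  have i4 := min_ineq hmin 0 (-1)
  have j1 := min_ineq hmin 1 1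
  have j2 := min_ineq hmin 1 (-1)
  have j3 := min_ineq hmin (-1) 1
  have j4 := min_ineq hmin (-1) (-1)
  clear hmin
  have H : 2 * |r| ≤ b ∧ 2 * |r| ≤ c ∧ 2 * |s| ≤ a ∧ 2 * |s| ≤ c ∧ 2 * |t| ≤ a ∧ 2 * |t| ≤ b := by
    grind
  refine ⟨H, ?_⟩
  obtain ⟨r1, r2, s1, s2, t1, t2⟩ := H
  rcases le_total a b with hab | hab <;> rcases le_total b c with hbc | hbc <;>
    rcases le_total a c with hac | hac
  · have := red_bound ha hab hbc r1 s1 t1 (by linarith) (by linarith) (by linarith) (by linarith)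
    linarith
  · have := red_bound ha hab hbc r1 s1 t1 (by linarith) (by linarith) (by linarith) (by linarith)
    linarith
  · have := red_bound ha hac hbc r2 t1 s1 (by linarith) (by linarith) (by linarith) (by linarith)
    linarith
  · have := red_bound hc hac hab t1 r2 s2 (by linarith) (by linarith) (by linarith) (by linarith)
    linarith
  · have := red_bound hb hab hac s1 r1 t2 (by linarith) (by linarith) (by linarith) (by linarith)
    linarith
  · have := red_bound hb hbc hac s2 t2 r1 (by linarith) (by linarith) (by linarith) (by linarith)
    linarith
  · have := red_bound hc hbc hab t2 s2 r2 (by linarith) (by linarith) (by linarith) (by linarith)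
    linarith
  · have := red_bound hc hbc hab t2 s2 r2 (by linarith) (by linarith) (by linarith) (by linarith)
    linarith

/-- Bilinear form attached to `tf`. -/
def tb (a b c r s t x y z x' y' z' : ℤ) : ℤ :=
  a * x * x' + b * y * y' + c * z * z' + r * (y * z' + z * y') + s * (x * z' + z * x') +
    t * (x * y' + y * x')

/-- Small coefficients searched when exhibiting an embedding. -/
def small : List ℤ := [-1, 0, 1]

/-- The form `(a,b,c,r,s,t)` embeds into `(A,B,C,R,S,T)` with small coefficients. -/
def Good_s7 (A B C R S T a b c r s t : ℤ) : Prop :=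
  ∃ x ∈ small, ∃ y ∈ small, ∃ z ∈ small, tf A B C R S T x y z = a ∧
  ∃ x' ∈ small, ∃ y' ∈ small, ∃ z' ∈ small, tf A B C R S T x' y' z' = b ∧
    tb A B C R S T x y z x' y' z' = t ∧
  ∃ x'' ∈ small, ∃ y'' ∈ small, ∃ z'' ∈ small, tf A B C R S T x'' y'' z'' = c ∧
    tb A B C R S T x y z x'' y'' z'' = s ∧ tb A B C R S T x' y' z' x'' y'' z'' = r

/-- The form is anisotropic modulo `p` outside its radical. -/
def Bad (p : ℕ) (a b c r s t : ℤ) : Prop :=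
  ∀ x ∈ Finset.range p, ∀ y ∈ Finset.range p, ∀ z ∈ Finset.range p,
    tf a b c r s t x y z % p = 0 →
    (a * x + t * y + s * z) % p = 0 ∧ (t * x + b * y + r * z) % p = 0 ∧
      (s * x + r * y + c * z) % p = 0

instance (A B C R S T a b c r s t : ℤ) : Decidable (Good_s7 A B C R S T a b c r s t) := by
  unfold Good_s7; infer_instance

instance (p : ℕ) (a b c r s t : ℤ) : Decidable (Bad p a b c r s t) := by
  unfold Bad; infer_instance

theorem Good_s7.rep {A B C R S T a b c r s t n : ℤ} (h : Good_s7 A B C R S T a b c r s t)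
    (hn : RepresentsInt (tmat a b c r s t) n) : RepresentsInt (tmat A B C R S T) n := by
  obtain ⟨x, -, y, -, z, -, rfl, x', -, y', -, z', -, rfl, rfl, x'', -, y'', -, z'', -,
    rfl, rfl, rfl⟩ := h
  rw [tmat_rep] at hn ⊢
  obtain ⟨u, v, w, rfl⟩ := hn
  refine ⟨x * u + x' * v + x'' * w, y * u + y' * v + y'' * w, z * u + z' * v + z'' * w, ?_⟩
  simp only [tf, tb]
  ring

theorem Bad.not_iso {p : ℕ} (hp : 0 < p) {a b c r s t : ℤ} (h : Bad p a b c r s t) :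
    ¬ Iso p (tmat a b c r s t) := by
  rintro ⟨v, hv, hv'⟩
  apply hv'
  rw [← vec3_eta v, tmat_val] at hv
  have hp' : (0 : ℤ) < p := by exact_mod_cast hp
  have red : ∀ k : ℤ, ∃ m ∈ Finset.range p, (m : ℤ) ≡ k [ZMOD p] := by
    intro k
    have h0 := Int.emod_nonneg k hp'.ne'
    have h1 := Int.emod_lt_of_pos k hp'
    refine ⟨(k % p).toNat, by rw [Finset.mem_range]; omega, ?_⟩
    rw [Int.toNat_of_nonneg h0]
    exact Int.mod_modEq _ _
  obtain ⟨x, hx, ex⟩ := red (v 0)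
  obtain ⟨y, hy, ey⟩ := red (v 1)
  obtain ⟨z, hz, ez⟩ := red (v 2)
  have e : tf a b c r s t x y z ≡ tf a b c r s t (v 0) (v 1) (v 2) [ZMOD p] := by
    unfold tf
    gcongr
  obtain ⟨h1, h2, h3⟩ := h x hx y hy z hz (by rw [e]; exact Int.emod_eq_zero_of_dvd hv)
  have e1 : a * x + t * y + s * z ≡ a * v 0 + t * v 1 + s * v 2 [ZMOD p] := by gcongr
  have e2 : t * x + b * y + r * z ≡ t * v 0 + b * v 1 + r * v 2 [ZMOD p] := by gcongr
  have e3 : s * x + r * y + c * z ≡ s * v 0 + r * v 1 + c * v 2 [ZMOD p] := by gcongr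
  rw [e1] at h1
  rw [e2] at h2
  rw [e3] at h3
  intro i
  fin_cases i <;> simp [tmat, Matrix.mulVec, dotProduct, Fin.sum_univ_three] <;>
    apply Int.dvd_of_emod_eq_zero <;> assumption

/-- The finite verification that reduced forms of determinant `d` are good or bad. -/
def Check (d : ℕ) (A B C R S T : ℤ) : Prop :=
  ∀ a ∈ Finset.Icc (1 : ℤ) (4 * d), ∀ b ∈ Finset.Icc (1 : ℤ) (4 * d / a),
  ∀ c ∈ Finset.Icc (1 : ℤ) (4 * d / (a * b)),
  ∀ r ∈ Finset.Icc (-(b / 2)) (b / 2), 2 * r ≤ c → -c ≤ 2 * r →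
  ∀ s ∈ Finset.Icc (-(a / 2)) (a / 2), 2 * s ≤ c → -c ≤ 2 * s →
  ∀ t ∈ Finset.Icc (-(a / 2)) (a / 2), 2 * t ≤ b → -b ≤ 2 * t →
  a * b * c + 2 * r * s * t - a * r ^ 2 - b * s ^ 2 - c * t ^ 2 = d →
  Good_s7 A B C R S T a b c r s t ∨ (d ≠ 1 ∧ Bad d a b c r s t)

theorem check1 : Check 1 1 1 1 0 0 0 := by unfold Check; decide +kernel
theorem check3 : Check 3 1 2 2 1 0 0 := by unfold Check; decide +kernel
theorem check5 : Check 5 1 1 5 0 0 0 := by unfold Check; decide +kernel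
theorem check7 : Check 7 2 2 3 1 1 1 := by unfold Check; decide +kernel

theorem class_one {d : ℕ} (hd : 0 < d) {A B C R S T : ℤ} (hch : Check d A B C R S T)
    {M : Matrix (Fin 3) (Fin 3) ℤ} (hM : IsPDForm M) (hdet : M.det = d) (hiso : d ≠ 1 → Iso d M)
    {n : ℤ} (hn : RepresentsInt M n) : RepresentsInt (tmat A B C R S T) n := by
  obtain ⟨N, hN, hmin⟩ := exists_min hM
  have pN := hN.pd hM
  have dN := hN.det
  have nN := hN.rep hn
  have iN : d ≠ 1 → Iso d N := fun h => hN.iso (hiso h)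
  have ha := diag_pos pN 0
  have hb := diag_pos pN 1
  have hc := diag_pos pN 2
  have hs := symm_eq_tmat pN.1
  generalize N 0 0 = a at *
  generalize N 1 1 = b at *
  generalize N 2 2 = c at *
  generalize N 1 2 = r at *
  generalize N 0 2 = s at *
  generalize N 0 1 = t at *
  subst hs
  rw [hdet, tmat_det] at dN
  obtain ⟨⟨r1, r2, s1, s2, t1, t2⟩, hbd⟩ := min_bound ha hb hc hmin
  rw [dN] at hbd
  have hab : 0 < a * b := by positivity
  have b1 : a * b * 1 ≤ a * b * c := mul_le_mul_of_nonneg_left hc hab.le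
  have b2 : a * 1 ≤ a * b := mul_le_mul_of_nonneg_left hb ha.le
  rcases hch a (Finset.mem_Icc.2 ⟨ha, by linarith⟩)
    b (Finset.mem_Icc.2 ⟨hb, (Int.le_ediv_iff_mul_le ha).2 (by linarith)⟩)
    c (Finset.mem_Icc.2 ⟨hc, (Int.le_ediv_iff_mul_le hab).2 (by linarith)⟩)
    r (Finset.mem_Icc.2 (by grind)) (by grind) (by grind)
    s (Finset.mem_Icc.2 (by grind)) (by grind) (by grind)
    t (Finset.mem_Icc.2 (by grind)) (by grind) (by grind) dN with h | ⟨h1, h⟩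
  · exact h.rep nN
  · exact absurd (iN h1) (h.not_iso hd)

theorem two_or_one_dvd {e q : ℕ} (he : e = 1 ∨ e = 2) (hq2 : q % 2 = 1) {x : ℤ}
    (h1 : (q : ℤ) ∣ x) (h2 : x % 2 = 0) : ((e * q : ℕ) : ℤ) ∣ x := by
  rcases he with rfl | rfl
  · simpa using h1
  · push_cast
    apply IsCoprime.mul_dvd _ (Int.dvd_of_emod_eq_zero h2) h1
    have : Nat.Coprime 2 q := (Nat.odd_iff.2 hq2).coprime_two_left
    exact_mod_cast Nat.isCoprime_iff_coprime.2 this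

theorem sq_odd {z : ℤ} (h : z % 2 = 1) : z ^ 2 % 2 = 1 := by
  rw [pow_two, Int.mul_emod, h]; rfl

/-- Construction when `d` does not divide `n`. -/
theorem construct1 {d e q b n : ℕ} (hd : d = 3 ∨ d = 5 ∨ d = 7) (he : e = 1 ∨ e = 2)
    (hq : q.Prime) (hq100 : 100 < q) (hdn : n.Coprime d)
    (hbd : b % d = d - 1) (h : e * q + d = b * n) (hbo : b % 2 = 1)
    (hJ : jacobiSym (-b) q = 1) :
    ∃ M : Matrix (Fin 3) (Fin 3) ℤ, IsPDForm M ∧ M.det = d ∧ (d ≠ 1 → Iso d M) ∧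
      RepresentsInt M n := by
  have hq2 : q % 2 = 1 := hq.eq_two_or_odd.resolve_left (by omega)
  obtain ⟨z, hz, -, hz2⟩ := root (d := 1) hq hq2 (by simp) (by norm_num) hJ
  have hzz := sq_odd hz2
  obtain ⟨w, hw⟩ := two_or_one_dvd he hq2 hz (by omega)
  have hZ : (e * q + d : ℤ) = b * n := by exact_mod_cast h
  push_cast at hw
  have hq0 : (0 : ℤ) < q := by exact_mod_cast hq.pos
  have he0 : (0 : ℤ) < e := by rcases he with rfl | rfl <;> norm_num
  have hb0 : (0 : ℤ) < b := by omega
  have hd0 : (0 : ℤ) < d := by omega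
  have hE : (0 : ℤ) < e * q := by positivity
  have hw0 : 0 < w := by
    by_contra hcon
    push Not at hcon
    have : (e * q : ℤ) * w ≤ 0 := mul_nonpos_of_nonneg_of_nonpos hE.le hcon
    nlinarith [sq_nonneg z]
  have hm : w * (e * q : ℤ) - z ^ 2 = b := by linarith
  have hdet : w * (e * q) * n + 2 * 0 * 1 * z - w * 0 ^ 2 - (e * q) * 1 ^ 2 - n * z ^ 2 = (d : ℤ) := by
    linear_combination n * hm + -hZ
  refine ⟨tmat w (e * q) n 0 1 z, tmat_pd hw0 (by rw [hm]; exact hb0) (by rw [hdet]; exact hd0), ?_,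
    fun _ => ?_, (tmat_rep _ _ _ _ _ _ _).2 ⟨0, 0, 1, by simp [tf]⟩⟩
  · rw [tmat_det, hdet]
  · have hbd' : (d : ℤ) ∣ b + 1 := by rcases hd with rfl | rfl | rfl <;> omega
    have hcb : IsCoprime (b : ℤ) d := by
      obtain ⟨k, hk⟩ := hbd'
      exact ⟨-1, k, by linarith⟩
    have hcn : IsCoprime (n : ℤ) d := Nat.isCoprime_iff_coprime.2 hdn
    obtain ⟨u, v, huv⟩ := hcb.mul_left hcn
    rw [← hZ] at huv
    have hu : u * (e * q : ℤ) = 1 - d * (u + v) := by linarith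
    refine ⟨![1, (1 - z) * u, 0], ?_, ?_⟩
    · rw [tmat_val]
      have hco : IsCoprime (d : ℤ) (e * q) := ⟨u + v, u, by linarith⟩
      apply hco.dvd_of_dvd_mul_left
      obtain ⟨k, hk⟩ := hbd'
      have : (e * q : ℤ) * tf w (e * q) n 0 1 z 1 ((1 - z) * u) 0
          = (u * (e * q) * (1 - z) + z) ^ 2 + b := by
        rw [← hm]; simp only [tf]; ring
      rw [this, hu]
      refine ⟨k + (d * (u + v) ^ 2 * (1 - z) ^ 2 - 2 * (u + v) * (1 - z)), ?_⟩
      linear_combination hk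
    · intro hall
      have h2 := hall 2
      simp [tmat, Matrix.mulVec, dotProduct, Fin.sum_univ_three] at h2
      have := Int.le_of_dvd one_pos h2
      omega

/-- Construction when `d` divides `n`. -/
theorem construct2 {d e q b n : ℕ} (hd : d = 1 ∨ d = 3 ∨ d = 5 ∨ d = 7) (he : e = 1 ∨ e = 2)
    (hq : q.Prime) (hq100 : 100 < q) (hdn : d ∣ n)
    (h : e * q + 1 = b * n) (hbo : b % 2 = 1)
    (hJ : jacobiSym (-(b * d : ℕ)) q = 1) :
    ∃ M : Matrix (Fin 3) (Fin 3) ℤ, IsPDForm M ∧ M.det = d ∧ (d ≠ 1 → Iso d M) ∧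
      RepresentsInt M n := by
  have hq2 : q % 2 = 1 := hq.eq_two_or_odd.resolve_left (by omega)
  have hqd : q.Coprime d := by
    rw [hq.coprime_iff_not_dvd]
    intro hh
    have := Nat.le_of_dvd (by omega) hh
    omega
  have hdo : d % 2 = 1 := by omega
  obtain ⟨z, hz, ⟨y, rfl⟩, hz2⟩ := root hq hq2 hqd hdo hJ
  have hy2 : y % 2 = 1 := by
    by_contra hcon
    have : y % 2 = 0 := by omega
    rw [Int.mul_emod, this] at hz2
    simp at hz2
  have hyy := sq_odd hy2
  have hz' : (q : ℤ) ∣ d * y ^ 2 + b := by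
    have hco : IsCoprime (q : ℤ) d := Nat.isCoprime_iff_coprime.2 hqd
    apply hco.dvd_of_dvd_mul_left
    have e1 : (d : ℤ) * (d * y ^ 2 + b) = (d * y) ^ 2 + (b * d : ℕ) := by push_cast; ring
    rw [e1]; exact hz
  have hpar : (d * y ^ 2 + b : ℤ) % 2 = 0 := by
    have : (d * y ^ 2 : ℤ) % 2 = 1 := by rw [Int.mul_emod, hyy]; omega
    omega
  obtain ⟨w, hw⟩ := two_or_one_dvd he hq2 hz' hpar
  have hZ : (e * q + 1 : ℤ) = b * n := by exact_mod_cast h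
  push_cast at hw
  have hq0 : (0 : ℤ) < q := by exact_mod_cast hq.pos
  have he0 : (0 : ℤ) < e := by rcases he with rfl | rfl <;> norm_num
  have hb0 : (0 : ℤ) < b := by omega
  have hd0 : (0 : ℤ) < d := by omega
  have hE : (0 : ℤ) < e * q := by positivity
  have hw0 : 0 < w := by
    by_contra hcon
    push Not at hcon
    have : (e * q : ℤ) * w ≤ 0 := mul_nonpos_of_nonneg_of_nonpos hE.le hcon
    have : (0 : ℤ) ≤ d * y ^ 2 := by positivity
    linarith
  have hm : w * (d * (e * q) : ℤ) - (d * y) ^ 2 = d * b := by linear_combination -d * hw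
  have hdet : w * (d * (e * q)) * n + 2 * 0 * 1 * (d * y) - w * 0 ^ 2 - (d * (e * q)) * 1 ^ 2
      - n * (d * y) ^ 2 = (d : ℤ) := by
    linear_combination n * hm + -d * hZ
  refine ⟨tmat w (d * (e * q)) n 0 1 (d * y), tmat_pd hw0 (by rw [hm]; positivity)
    (by rw [hdet]; exact hd0), ?_,
    fun hd1 => ?_, (tmat_rep _ _ _ _ _ _ _).2 ⟨0, 0, 1, by simp [tf]⟩⟩
  · rw [tmat_det, hdet]
  · refine ⟨![0, 0, 1], ?_, ?_⟩
    · rw [tmat_val]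
      simpa [tf] using Int.natCast_dvd_natCast.2 hdn
    · intro hall
      have h2 := hall 0
      simp [tmat, Matrix.mulVec, dotProduct, Fin.sum_univ_three] at h2
      have := Int.le_of_dvd one_pos h2
      omega

theorem odd_coprime_pow {a : ℕ} (h : a % 2 = 1) : a.Coprime 8 :=
  Nat.Coprime.pow_right 3 (Nat.odd_iff.2 h).coprime_two_right

theorem odd_coprime_four {a : ℕ} (h : a % 2 = 1) : a.Coprime 4 :=
  Nat.Coprime.pow_right 2 (Nat.odd_iff.2 h).coprime_two_right

/-- Existence of a suitable form of determinant `d` representing `n`. -/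
theorem exists_form {d n : ℕ} (hd : d = 1 ∨ d = 3 ∨ d = 5 ∨ d = 7)
    (hn : n % 4 = 2 ∨ (n * d) % 8 = 3 ∨ (n * d) % 4 = 1) :
    ∃ M : Matrix (Fin 3) (Fin 3) ℤ, IsPDForm M ∧ M.det = d ∧ (d ≠ 1 → Iso d M) ∧
      RepresentsInt M n := by
  have hn0 : 0 < n := by
    rcases Nat.eq_zero_or_pos n with rfl | h
    · simp at hn
    · exact h
  by_cases hdn : d ∣ n
  · -- first case: the determinant divides the number
    have step : ∀ e b0 a0 m : ℕ, (e = 1 ∨ e = 2) → e * m = 8 → e * a0 + 1 = b0 * n → a0 % 2 = 1 →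
        ((e = 1 ∧ n % 4 = 2 ∧ (b0 * d) % 8 = 1) ∨ (e = 2 ∧ (b0 * d) % 8 = 1 ∧ (n * d) % 8 = 3) ∨
          (e = 2 ∧ (b0 * d) % 8 = 3 ∧ (n * d) % 4 = 1)) →
        ∃ M : Matrix (Fin 3) (Fin 3) ℤ, IsPDForm M ∧ M.det = d ∧ (d ≠ 1 → Iso d M) ∧
          RepresentsInt M n := by
      intro e b0 a0 m he hem h0 ha0 hc
      have hco : a0.Coprime (m * n) := by
        apply Nat.Coprime.mul_right
        · exact Nat.Coprime.coprime_dvd_right (Dvd.intro_left _ hem) (odd_coprime_pow ha0)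
        · apply Nat.isCoprime_iff_coprime.1
          refine ⟨-e, b0, ?_⟩
          have : (e * a0 + 1 : ℤ) = b0 * n := by exact_mod_cast h0
          linarith
      have hm0 : m * n ≠ 0 := by
        have : m ≠ 0 := by rintro rfl; simp at hem
        exact Nat.mul_ne_zero this hn0.ne'
      obtain ⟨q, k, hq, hq100, hqk⟩ := dir h0 hm0 hco
      rw [hem] at hqk
      have hq2 : q % 2 = 1 := hq.eq_two_or_odd.resolve_left (by omega)
      have e1 : (b0 + 8 * k) * d % 8 = b0 * d % 8 := by
        rw [Nat.add_mul, Nat.mul_assoc, Nat.add_mul_mod_self_left]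
      have hbo : (b0 + 8 * k) % 2 = 1 := by
        rcases hd with rfl | rfl | rfl | rfl <;> omega
      exact construct2 hd he hq hq100 hdn hqk hbo (jac2_s7 hd hq2 hdn hqk (by rw [e1]; exact hc))
    have hdd : d * d % 8 = 1 := by rcases hd with rfl | rfl | rfl | rfl <;> rfl
    have hdd3 : 3 * d * d % 8 = 3 := by rcases hd with rfl | rfl | rfl | rfl <;> rfl
    rcases hn with h | h | h
    · have hdn4 : d * n % 4 = 2 := by rcases hd with rfl | rfl | rfl | rfl <;> omega
      exact step 1 d (d * n - 1) 8 (by simp) rfl (by omega) (by omega) (Or.inl ⟨rfl, h, hdd⟩)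
    · rw [Nat.mul_comm] at h
      exact step 2 d ((d * n - 1) / 2) 4 (by simp) rfl (by omega) (by omega)
        (Or.inr (Or.inl ⟨rfl, hdd, by rwa [Nat.mul_comm]⟩))
    · rw [Nat.mul_comm] at h
      have h3 : 3 * d * n = 3 * (d * n) := by ring
      exact step 2 (3 * d) ((3 * d * n - 1) / 2) 4 (by simp) rfl (by omega) (by omega)
        (Or.inr (Or.inr ⟨rfl, hdd3, by rwa [Nat.mul_comm]⟩))
  · have hd' : d = 3 ∨ d = 5 ∨ d = 7 := by
      rcases hd with rfl | h
      · exact absurd (one_dvd n) hdn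
      · exact h
    have hdp : d.Prime := by rcases hd' with rfl | rfl | rfl <;> norm_num
    have hcnd : n.Coprime d := ((hdp.coprime_iff_not_dvd).2 hdn).symm
    have step : ∀ e b0 a0 m : ℕ, (e = 1 ∨ e = 2) → e * m = 8 → e * a0 + d = b0 * n → a0 % 2 = 1 →
        b0 % d = d - 1 →
        ((e = 1 ∧ n % 4 = 2 ∧ b0 % 8 = 1) ∨ (e = 2 ∧ b0 % 8 = 1 ∧ (n * d) % 8 = 3) ∨
          (e = 2 ∧ b0 % 8 = 3 ∧ (n * d) % 4 = 1)) →
        ∃ M : Matrix (Fin 3) (Fin 3) ℤ, IsPDForm M ∧ M.det = d ∧ (d ≠ 1 → Iso d M) ∧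
          RepresentsInt M n := by
      intro e b0 a0 m he hem h0 ha0 hbd hc
      have hm1 : m ≠ 0 := by rintro rfl; simp at hem
      have hbcd : b0.Coprime d := by
        rw [Nat.coprime_comm, hdp.coprime_iff_not_dvd]
        intro hh
        have := Nat.mod_eq_zero_of_dvd hh
        omega
      have hco1 : (a0).Coprime d := by
        have : (b0 * n).Coprime d := hbcd.mul_left hcnd
        rw [← h0, Nat.coprime_add_self_left] at this
        exact Nat.Coprime.coprime_mul_left this
      have hco2 : (a0).Coprime n := by
        have h1 : (e * a0 + d).gcd n = n := by
          rw [h0]; simp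
        have hg1 : a0.gcd n ∣ d := by
          have h2 : a0.gcd n ∣ e * a0 + d := by
            rw [h0]; exact (Nat.gcd_dvd_right a0 n).mul_left b0
          exact (Nat.dvd_add_right ((Nat.gcd_dvd_left a0 n).mul_left e)).1 h2
        have hg2 : a0.gcd n ∣ n.gcd d := Nat.dvd_gcd (Nat.gcd_dvd_right a0 n) hg1
        rw [hcnd] at hg2
        exact Nat.dvd_one.1 hg2
      have hco : a0.Coprime (m * d * n) := by
        apply Nat.Coprime.mul_right _ hco2
        apply Nat.Coprime.mul_right _ hco1
        exact Nat.Coprime.coprime_dvd_right (Dvd.intro_left _ hem) (odd_coprime_pow ha0)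
      have hm0 : m * d * n ≠ 0 := Nat.mul_ne_zero (Nat.mul_ne_zero hm1 hdp.pos.ne') hn0.ne'
      obtain ⟨q, k, hq, hq100, hqk⟩ := dir h0 hm0 hco
      have e0 : e * (m * d) * k = 8 * (d * k) := by rw [← hem]; ring
      rw [e0] at hqk
      have hq2 : q % 2 = 1 := hq.eq_two_or_odd.resolve_left (by omega)
      have e1 : (b0 + 8 * (d * k)) % 8 = b0 % 8 := by omega
      have e2 : (b0 + 8 * (d * k)) % d = d - 1 := by
        rw [show 8 * (d * k) = d * (8 * k) by ring, Nat.add_mul_mod_self_left, hbd]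
      have hbo : (b0 + 8 * (d * k)) % 2 = 1 := by omega
      exact construct1 hd' he hq hq100 hcnd e2 hqk hbo (jac1_s7 hd' hq2 e2 hqk (by rw [e1]; exact hc))
    have bex : ∀ j, j = 1 ∨ j = 3 → ∃ b0, b0 % 8 = j ∧ b0 % d = d - 1 ∧ d < b0 := by
      intro j hj
      rcases hd' with rfl | rfl | rfl <;> rcases hj with rfl | rfl
      · exact ⟨17, by norm_num⟩
      · exact ⟨11, by norm_num⟩
      · exact ⟨9, by norm_num⟩
      · exact ⟨19, by norm_num⟩
      · exact ⟨41, by norm_num⟩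
      · exact ⟨27, by norm_num⟩
    obtain ⟨b1, hb1, hb1d, hb1l⟩ := bex 1 (by simp)
    obtain ⟨b3, hb3, hb3d, hb3l⟩ := bex 3 (by simp)
    have l1 : b1 * 1 ≤ b1 * n := Nat.mul_le_mul_left _ hn0
    have l3 : b3 * 1 ≤ b3 * n := Nat.mul_le_mul_left _ hn0
    have m1 : b1 * n % 8 = n % 8 := by rw [Nat.mul_mod, hb1]; simp
    have m3 : b3 * n % 8 = 3 * (n % 8) % 8 := by rw [Nat.mul_mod, hb3]
    rcases hn with h | h | h
    · exact step 1 b1 (b1 * n - d) 8 (by simp) rfl (by omega) (by omega) hb1d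
        (Or.inl ⟨rfl, h, hb1⟩)
    · have : n % 8 = 3 * d % 8 := by rcases hd' with rfl | rfl | rfl <;> omega
      have hdo : d % 2 = 1 := by omega
      exact step 2 b1 ((b1 * n - d) / 2) 4 (by simp) rfl (by omega) (by omega) hb1d
        (Or.inr (Or.inl ⟨rfl, hb1, h⟩))
    · have : n % 4 = d % 4 := by rcases hd' with rfl | rfl | rfl <;> omega
      have hdo : d % 2 = 1 := by omega
      exact step 2 b3 ((b3 * n - d) / 2) 4 (by simp) rfl (by omega) (by omega) hb3d
        (Or.inr (Or.inr ⟨rfl, hb3, h⟩))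

/-- The four forms. -/
def G (d : ℕ) : Matrix (Fin 3) (Fin 3) ℤ :=
  if d = 1 then tmat 1 1 1 0 0 0 else if d = 3 then tmat 1 2 2 1 0 0
  else if d = 5 then tmat 1 1 5 0 0 0 else tmat 2 2 3 1 1 1

theorem G_rep {d n : ℕ} (hd : d = 1 ∨ d = 3 ∨ d = 5 ∨ d = 7)
    (hn : n % 4 = 2 ∨ (n * d) % 8 = 3 ∨ (n * d) % 4 = 1) : RepresentsInt (G d) n := by
  obtain ⟨M, h1, h2, h3, h4⟩ := exists_form hd hn
  rcases hd with rfl | rfl | rfl | rfl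
  · exact class_one (by norm_num) check1 h1 h2 h3 h4
  · exact class_one (by norm_num) check3 h1 h2 h3 h4
  · exact class_one (by norm_num) check5 h1 h2 h3 h4
  · exact class_one (by norm_num) check7 h1 h2 h3 h4

theorem G_pd {d : ℕ} (hd : d = 1 ∨ d = 3 ∨ d = 5 ∨ d = 7) : IsPDForm (G d) := by
  rcases hd with rfl | rfl | rfl | rfl <;> apply tmat_pd <;> norm_num

theorem rep_mul {M : Matrix (Fin 3) (Fin 3) ℤ} {n : ℤ} (k : ℕ) (h : RepresentsInt M n) :
    RepresentsInt M (4 ^ k * n) := by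
  obtain ⟨v, rfl⟩ := h
  refine ⟨(2 : ℤ) ^ k • v, ?_⟩
  rw [Matrix.mulVec_smul, smul_dotProduct, dotProduct_smul]
  simp only [smul_eq_mul]
  rw [show (4 : ℤ) = 2 * 2 by norm_num, mul_pow]
  ring

theorem G_rep_odd {d m : ℕ} (k : ℕ) (hd : d = 1 ∨ d = 3 ∨ d = 5 ∨ d = 7) (hm : m % 2 = 1)
    (h : m % 8 ≠ 8 - d) : RepresentsInt (G d) (4 ^ k * m) := by
  apply rep_mul
  apply G_rep hd
  rcases hd with rfl | rfl | rfl | rfl <;> omega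

theorem G_rep_even {d m : ℕ} (k : ℕ) (hd : d = 1 ∨ d = 3 ∨ d = 5 ∨ d = 7) (hm : m % 2 = 1) :
    RepresentsInt (G d) (4 ^ k * (2 * m)) := by
  apply rep_mul
  have := G_rep (n := 2 * m) hd (by omega)
  exact_mod_cast this

theorem two_smul_pd {M : Matrix (Fin 3) (Fin 3) ℤ} (h : IsPDForm M) : IsPDForm (2 • M) := by
  constructor
  · have := h.1
    unfold Matrix.IsSymm at *
    rw [Matrix.transpose_smul, this]
  · intro v hv
    rw [Matrix.smul_mulVec, dotProduct_smul]
    have := h.2 v hv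
    simpa using this

theorem two_smul_rep {M : Matrix (Fin 3) (Fin 3) ℤ} {n : ℤ} (h : RepresentsInt M n) :
    RepresentsInt (2 • M) (2 * n) := by
  obtain ⟨v, rfl⟩ := h
  refine ⟨v, ?_⟩
  rw [Matrix.smul_mulVec, dotProduct_smul]
  simp

/-- Any seven even positive integers are simultaneously represented by some positive
definite integral ternary quadratic form. -/
theorem seven_even_integers_represented (a : Fin 7 → ℕ)
    (ha : ∀ i, 0 < a i) (he : ∀ i, Even (a i)) :
    ∃ M : Matrix (Fin 3) (Fin 3) ℤ, IsPDForm M ∧ ∀ i, RepresentsInt M (a i : ℤ) := by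
  have hdec : ∀ i, ∃ k m : ℕ, m % 2 = 1 ∧ a i = 2 ^ k * m := by
    intro i
    obtain ⟨k, m, hm, h⟩ := Nat.exists_eq_two_pow_mul_odd (ha i).ne'
    exact ⟨k, m, Nat.odd_iff.1 hm, h⟩
  choose k m hm hk using hdec
  have hk0 : ∀ i, k i ≠ 0 := by
    intro i h0
    have h1 := hk i
    have h2 := Nat.even_iff.1 (he i)
    have h3 := hm i
    rw [h0] at h1
    omega
  -- the seven square classes cannot exhaust all eight
  have hpig : ∃ c : Fin 2 × Fin 4, ∀ i, ¬ (k i % 2 = c.1.val ∧ m i % 8 = 8 - (2 * c.2.val + 1)) := by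
    by_contra hcon
    push Not at hcon
    choose f hf using hcon
    have hinj : Function.Injective f := by
      intro c c' hcc
      have h1 := hf c
      have h2 := hf c'
      rw [hcc] at h1
      have := c.2.isLt
      have := c'.2.isLt
      apply Prod.ext <;> apply Fin.ext <;> omega
    have := Fintype.card_le_of_injective f hinj
    simp at this
  obtain ⟨⟨p, j⟩, hc⟩ := hpig
  simp only at hc
  have hd : ∃ d, d = 2 * j.val + 1 ∧ (d = 1 ∨ d = 3 ∨ d = 5 ∨ d = 7) := by
    have := j.isLt
    exact ⟨_, rfl, by omega⟩
  obtain ⟨d, hdj, hd⟩ := hd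
  rw [← hdj] at hc
  have hp : p.val = 0 ∨ p.val = 1 := by omega
  rcases hp with hp | hp <;> rw [hp] at hc
  · refine ⟨G d, G_pd hd, fun i => ?_⟩
    rcases Nat.even_or_odd' (k i) with ⟨l, hl | hl⟩
    · have := G_rep_odd l hd (hm i) (fun h => hc i ⟨by omega, h⟩)
      convert this using 1
      rw [hk i, hl, pow_mul]; push_cast; norm_num
    · have := G_rep_even l hd (hm i)
      convert this using 1
      rw [hk i, hl, pow_succ, pow_mul]; push_cast; ring
  · refine ⟨2 • G d, two_smul_pd (G_pd hd), fun i => ?_⟩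
    rcases Nat.even_or_odd' (k i) with ⟨l, hl | hl⟩
    · obtain ⟨l', rfl⟩ : ∃ l', l = l' + 1 := ⟨l - 1, by have := hk0 i; omega⟩
      have := two_smul_rep (G_rep_even l' hd (hm i))
      convert this using 1
      rw [hk i, hl, pow_mul]; push_cast; ring
    · have := two_smul_rep (G_rep_odd l hd (hm i) (fun h => hc i ⟨by omega, h⟩))
      convert this using 1
      rw [hk i, hl, pow_succ, pow_mul]; push_cast; ring
end
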